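/- arXiv:0809.2057 — 3 statements merged into one kernel-verified Lean document; each statement's English description precedes it below -/
import Mathlib

section
/- For λ > 0, let M^λ_j = exp(λ·j²/4) and let g_λ : ℝ → ℝ be defined by g_λ(x) = exp(−(ln x)²/λ) for x > 0 and g_λ(x) = 0 for x ≤ 0. Then g_λ is C^∞ on ℝ, flat at 0 (all derivatives vanish at 0), and its germ at 0 belongs to E_1(M^λ); explicitly, |g_λ^{(j)}(x)| ≤ e^{1/λ}·(2e^{1/4})^j·j!·exp(λ·j²/4) for all j ∈ ℕ and all x < 1. -/
open Set Filter Topology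

noncomputable section

/-- The germ at `0` of `h : ℝ → ℝ` belongs to the Denjoy–Carleman class `E₁(M)`. -/
def GermInDC (M : ℕ → ℝ) (h : ℝ → ℝ) : Prop :=
  ∃ ε > (0:ℝ), ∃ C > (0:ℝ), ∃ σ > (0:ℝ),
    ContDiffOn ℝ (⊤ : ℕ∞) h (Ioo (-ε) ε) ∧
    ∀ (j : ℕ), ∀ x ∈ Ioo (-ε) ε,
      |iteratedDeriv j h x| ≤ C * σ ^ j * (Nat.factorial j : ℝ) * M j

/-- The function `g_λ`. -/
def gfun (lam : ℝ) : ℝ → ℝ := fun x =>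
  if 0 < x then Real.exp (-(Real.log x) ^ 2 / lam) else 0

/-- The holomorphic extension of `g_λ` to the slit plane. -/
def gext (lam : ℝ) (z : ℂ) : ℂ := Complex.exp (-(Complex.log z) ^ 2 / (lam : ℂ))

lemma gext_analyticAt (lam : ℝ) {z : ℂ} (hz : z ∈ Complex.slitPlane) :
    AnalyticAt ℂ (gext lam) z := by
  unfold gext
  have h : AnalyticAt ℂ Complex.log z := analyticAt_clog hz
  exact (((h.pow 2).neg).div_const).cexp

lemma gext_iter_analyticAt (lam : ℝ) (n : ℕ) {z : ℂ} (hz : z ∈ Complex.slitPlane) :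
    AnalyticAt ℂ (iteratedDeriv n (gext lam)) z := by
  induction n with
  | zero => simpa using gext_analyticAt lam hz
  | succ n ih => rw [iteratedDeriv_succ]; exact ih.deriv

lemma ball_geom {x : ℝ} (hx : 0 < x) {z : ℂ}
    (hz : z ∈ Metric.closedBall (x : ℂ) (2 / 3 * x)) :
    0 < z.re ∧ 9 * z.im ^ 2 ≤ 4 * (z.re ^ 2 + z.im ^ 2) ∧ ‖z‖ ≤ 5 / 3 * x := by
  rw [mem_closedBall_iff_norm] at hz
  have h1 : ‖z - x‖ ^ 2 ≤ (2 / 3 * x) ^ 2 := by gcongr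
  rw [← Complex.normSq_eq_norm_sq, Complex.normSq_apply] at h1
  simp only [Complex.sub_re, Complex.ofReal_re, Complex.sub_im, Complex.ofReal_im, sub_zero] at h1
  refine ⟨?_, ?_, ?_⟩
  · by_contra h
    push Not at h
    nlinarith [sq_nonneg z.im, mul_nonneg hx.le (neg_nonneg.2 h), mul_pos hx hx]
  · nlinarith [sq_nonneg (3 * z.re - 5 / 3 * x)]
  · have : ‖z‖ ≤ ‖z - x‖ + ‖(x : ℂ)‖ := by simpa using norm_add_le (z - x) (x : ℂ)
    rw [Complex.norm_real, Real.norm_of_nonneg hx.le] at this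
    linarith

lemma arg_sq_le_one {z : ℂ} (h0 : 0 < z.re)
    (h : 9 * z.im ^ 2 ≤ 4 * (z.re ^ 2 + z.im ^ 2)) : z.arg ^ 2 ≤ 1 := by
  have hn : 0 < ‖z‖ := norm_pos_iff.2 (by rintro rfl; simp at h0)
  have hs : |Real.sin z.arg| ≤ 2 / 3 := by
    rw [Complex.sin_arg, abs_div, abs_norm, div_le_iff₀ hn]
    apply abs_le_of_sq_le_sq _ (by positivity)
    have := Complex.normSq_eq_norm_sq z
    rw [Complex.normSq_apply] at this
    nlinarith
  have hpi : |z.arg| ≤ Real.pi / 2 := Complex.abs_arg_le_pi_div_two_iff.2 h0.le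
  have h1 : (1 : ℝ) - 1 ^ 3 / 6 < Real.sin 1 := Real.sin_gt_sub_cube one_pos
  have hp := Real.pi_gt_three
  rw [sq_le_one_iff_abs_le_one]
  by_contra hc
  push Not at hc
  have h2 : Real.sin 1 < Real.sin |z.arg| :=
    Real.sin_lt_sin_of_lt_of_le_pi_div_two (by linarith) hpi hc
  have h3 : Real.sin |z.arg| ≤ |Real.sin z.arg| := by
    rcases abs_cases z.arg with ⟨h, _⟩ | ⟨h, _⟩
    · rw [h]; exact le_abs_self _
    · rw [h, Real.sin_neg]; exact neg_le_abs _
  norm_num at h1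
  linarith

lemma gext_bound {lam : ℝ} (hlam : 0 < lam) (m : ℕ) {z : ℂ} (h0 : z ≠ 0)
    (ha : z.arg ^ 2 ≤ 1) :
    ‖gext lam z‖ ≤ Real.exp (1 / lam) * Real.exp (lam * (m : ℝ) ^ 2 / 4) * ‖z‖ ^ m := by
  have hn : 0 < ‖z‖ := norm_pos_iff.2 h0
  have hpow : ‖z‖ ^ m = Real.exp (m * Real.log ‖z‖) := by
    rw [Real.exp_nat_mul, Real.exp_log hn]
  rw [hpow, ← Real.exp_add, ← Real.exp_add, gext, Complex.norm_exp]
  apply Real.exp_le_exp.2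
  have hre : (-(Complex.log z) ^ 2 / (lam : ℂ)).re =
      (-(Real.log ‖z‖) ^ 2 + z.arg ^ 2) / lam := by
    rw [Complex.div_ofReal_re, Complex.neg_re, sq, Complex.mul_re, Complex.log_re, Complex.log_im]
    ring
  rw [hre]
  set v := Real.log ‖z‖
  have key : 1 / lam + lam * (m : ℝ) ^ 2 / 4 + m * v - (-v ^ 2 + z.arg ^ 2) / lam =
      ((1 - z.arg ^ 2) + (v + lam * m / 2) ^ 2) / lam := by
    field_simp
    ring
  have : 0 ≤ ((1 - z.arg ^ 2) + (v + lam * m / 2) ^ 2) / lam :=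
    div_nonneg (add_nonneg (by linarith) (sq_nonneg _)) hlam.le
  linarith

lemma gext_iter_bound {lam : ℝ} (hlam : 0 < lam) (n m : ℕ) {x : ℝ} (hx : 0 < x) :
    ‖iteratedDeriv n (gext lam) (x : ℂ)‖ ≤ (n.factorial : ℝ) *
      (Real.exp (1 / lam) * Real.exp (lam * (m : ℝ) ^ 2 / 4) * (5 / 3 * x) ^ m) /
        (2 / 3 * x) ^ n := by
  apply Complex.norm_iteratedDeriv_le_of_forall_mem_sphere_norm_le n (by positivity)
  · refine DifferentiableOn.diffContOnCl_ball (U := Complex.slitPlane) ?_ ?_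
    · intro z hz
      exact (gext_analyticAt lam hz).differentiableAt.differentiableWithinAt
    · intro z hz
      exact Or.inl (ball_geom hx hz).1
  · intro z hz
    obtain ⟨h1, h2, h3⟩ := ball_geom hx (Metric.sphere_subset_closedBall hz)
    refine (gext_bound hlam m (by rintro rfl; simp at h1) (arg_sq_le_one h1 h2)).trans ?_
    gcongr

/-- The candidate for the `n`-th derivative of `g_λ`. -/
def gder (lam : ℝ) (n : ℕ) (x : ℝ) : ℝ :=
  if 0 < x then (iteratedDeriv n (gext lam) (x : ℂ)).re else 0

lemma gder_bound {lam : ℝ} (hlam : 0 < lam) (n m : ℕ) {x : ℝ} (hx : 0 < x) :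
    |gder lam n x| ≤ (n.factorial : ℝ) *
      (Real.exp (1 / lam) * Real.exp (lam * (m : ℝ) ^ 2 / 4) * (5 / 3 * x) ^ m) /
        (2 / 3 * x) ^ n := by
  rw [gder, if_pos hx]
  exact (Complex.abs_re_le_norm _).trans (gext_iter_bound hlam n m hx)

lemma gder_hasDerivAt {lam : ℝ} (hlam : 0 < lam) (n : ℕ) (x : ℝ) :
    HasDerivAt (gder lam n) (gder lam (n + 1) x) x := by
  rcases lt_trichotomy x 0 with hx | hx | hx
  · rw [gder, if_neg (not_lt.2 hx.le)]
    refine (hasDerivAt_const x (0 : ℝ)).congr_of_eventuallyEq ?_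
    filter_upwards [Iio_mem_nhds hx] with y hy
    rw [gder, if_neg (not_lt.2 (le_of_lt hy))]
  · subst hx
    rw [gder, if_neg (lt_irrefl _)]
    have hO : gder lam n =O[𝓝 0] fun y : ℝ => ‖y - 0‖ ^ 2 := by
      apply Asymptotics.IsBigO.of_bound ((n.factorial : ℝ) *
        (Real.exp (1 / lam) * Real.exp (lam * ((n + 2 : ℕ) : ℝ) ^ 2 / 4) * (5 / 3) ^ (n + 2)) /
        (2 / 3) ^ n)
      filter_upwards with y
      by_cases hy : 0 < y
      · refine (gder_bound hlam n (n + 2) hy).trans (le_of_eq ?_)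
        rw [sub_zero, norm_pow, norm_norm, Real.norm_of_nonneg hy.le, mul_pow, mul_pow]
        field_simp
        ring
      · rw [gder, if_neg hy, norm_zero]
        positivity
    have h := (hO.hasFDerivAt (𝕜 := ℝ) one_lt_two).hasDerivAt
    simpa using h
  · rw [gder, if_pos hx]
    have hz : (x : ℂ) ∈ Complex.slitPlane := Or.inl (by simpa using hx)
    have h := (gext_iter_analyticAt lam n hz).differentiableAt.hasDerivAt.real_of_complex
    rw [← iteratedDeriv_succ] at h
    refine h.congr_of_eventuallyEq ?_
    filter_upwards [Ioi_mem_nhds hx] with y hy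
    rw [gder, if_pos (mem_Ioi.1 hy)]

lemma gder_zero (lam : ℝ) : gder lam 0 = gfun lam := by
  funext x
  unfold gder gfun
  split_ifs with hx
  · rw [iteratedDeriv_zero, gext, ← Complex.ofReal_log hx.le]
    norm_cast
  · rfl

lemma iteratedDeriv_gfun {lam : ℝ} (hlam : 0 < lam) (n : ℕ) :
    iteratedDeriv n (gfun lam) = gder lam n := by
  induction n with
  | zero => rw [iteratedDeriv_zero, gder_zero]
  | succ n ih =>
    rw [iteratedDeriv_succ, ih]
    funext x
    exact (gder_hasDerivAt hlam n x).deriv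

lemma gfun_bound {lam : ℝ} (hlam : 0 < lam) (j : ℕ) (x : ℝ) :
    |iteratedDeriv j (gfun lam) x| ≤
        Real.exp (1 / lam) * (2 * Real.exp (1/4 : ℝ)) ^ j *
          (Nat.factorial j : ℝ) * Real.exp (lam * (j:ℝ) ^ 2 / 4) := by
  rw [iteratedDeriv_gfun hlam]
  by_cases hx : 0 < x
  · refine (gder_bound hlam j j hx).trans ?_
    have h1 : (5 / 3 * x) ^ j / (2 / 3 * x) ^ j = (5 / 2 : ℝ) ^ j := by
      rw [← div_pow]
      congr 1
      field_simp
    have h2 : (5 / 2 : ℝ) ≤ 2 * Real.exp (1 / 4) := by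
      have := Real.add_one_le_exp (1 / 4 : ℝ)
      linarith
    have h3 : (5 / 2 : ℝ) ^ j ≤ (2 * Real.exp (1 / 4)) ^ j := by gcongr
    calc _ = Real.exp (1 / lam) * ((5 / 3 * x) ^ j / (2 / 3 * x) ^ j) *
          (Nat.factorial j : ℝ) * Real.exp (lam * (j:ℝ) ^ 2 / 4) := by ring
      _ ≤ _ := by rw [h1]; gcongr
  · rw [gder, if_neg hx, abs_zero]
    positivity

/-- `g_λ` is `C^∞` on `ℝ`, flat at `0`, and belongs to `E₁(M^λ)` where
`M^λ_j = exp(λ j²/4)`, with the explicit bound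
`|g_λ^(j)(x)| ≤ e^{1/λ}·(2e^{1/4})^j·j!·exp(λ j²/4)` for `x < 1`. -/
theorem gfun_in_class (lam : ℝ) (hlam : 0 < lam) :
    ContDiff ℝ (⊤ : ℕ∞) (gfun lam) ∧
    (∀ j : ℕ, iteratedDeriv j (gfun lam) 0 = 0) ∧
    GermInDC (fun j => Real.exp (lam * (j:ℝ) ^ 2 / 4)) (gfun lam) ∧
    (∀ (j : ℕ) (x : ℝ), x < 1 →
      |iteratedDeriv j (gfun lam) x| ≤
        Real.exp (1 / lam) * (2 * Real.exp (1/4 : ℝ)) ^ j *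
          (Nat.factorial j : ℝ) * Real.exp (lam * (j:ℝ) ^ 2 / 4)) := by
  have hsm : ContDiff ℝ (⊤ : ℕ∞) (gfun lam) := by
    apply contDiff_of_differentiable_iteratedDeriv
    intro m _ x
    rw [iteratedDeriv_gfun hlam]
    exact (gder_hasDerivAt hlam m x).differentiableAt
  refine ⟨hsm, ?_, ?_, fun j x _ => gfun_bound hlam j x⟩
  · intro j
    rw [iteratedDeriv_gfun hlam, gder, if_neg (lt_irrefl _)]
  · exact ⟨1, one_pos, Real.exp (1 / lam), Real.exp_pos _, 2 * Real.exp (1/4 : ℝ), by positivity,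
      hsm.contDiffOn, fun j x _ => gfun_bound hlam j x⟩
end
end

section
/- Let M : ℕ → ℝ be a strongly regular sequence. Then there exists γ_0 ∈ (0, 2] such that for every γ with 0 < γ < γ_0 and every formal power series F = ∑_{j≥0} F_j x^j with real (or complex) coefficients satisfying |F_j| ≤ C·σ^j·M_j for all j (for some constants C, σ > 0), there exists f ∈ A_M(S_{γ,∞}) whose asymptotic expansion at the vertex is F, i.e. f^{(j)}(z) → j!·F_j as z → 0 in S_{γ,∞}, for every j ∈ ℕ. (Borel–Ritt type extension theorem.) -/
open Set Filter Topology Complex ENNReal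

noncomputable section

/-- The sector `S_{γ,r}` of the complex plane: `0 < |z| < r`, `|arg z| < γπ/2`. -/
def Sector (γ : ℝ) (r : ℝ≥0∞) : Set ℂ :=
  {z : ℂ | z ≠ 0 ∧ |Complex.arg z| < γ * Real.pi / 2 ∧ (‖z‖₊ : ℝ≥0∞) < r}

/-- `f ∈ A^∞(S_{γ,r})`: `f` is holomorphic on the sector and all its derivatives
are bounded there. -/
def AInfty (γ : ℝ) (r : ℝ≥0∞) (f : ℂ → ℂ) : Prop :=
  DifferentiableOn ℂ f (Sector γ r) ∧
  ∀ j : ℕ, ∃ B : ℝ, ∀ z ∈ Sector γ r, ‖iteratedDeriv j f z‖ ≤ B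

/-- `f ∈ A_M(S_{γ,r})`: `f ∈ A^∞(S_{γ,r})` with Denjoy–Carleman bounds. -/
def AClass (M : ℕ → ℝ) (γ : ℝ) (r : ℝ≥0∞) (f : ℂ → ℂ) : Prop :=
  AInfty γ r f ∧
  ∃ C > (0:ℝ), ∃ σ > (0:ℝ), ∀ (j : ℕ), ∀ z ∈ Sector γ r,
    ‖iteratedDeriv j f z‖ ≤ C * σ ^ j * (Nat.factorial j : ℝ) * M j

/-- `f` is flat on `S_{γ,r}`: every derivative tends to `0` at the vertex. -/
def FlatOn (γ : ℝ) (r : ℝ≥0∞) (f : ℂ → ℂ) : Prop :=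
  ∀ j : ℕ, Tendsto (iteratedDeriv j f) (𝓝[Sector γ r] 0) (𝓝 0)

/-- The function `h_M` associated with the sequence `M`. -/
def hFun (M : ℕ → ℝ) (t : ℝ) : ℝ := if t = 0 then 0 else ⨅ j : ℕ, t ^ j * M j

/-- `M` is a strongly regular sequence: positive, normalized, increasing,
log-convex, of moderate growth and strongly non-quasianalytic. -/
def StronglyRegular (M : ℕ → ℝ) : Prop :=
  (∀ j, 0 < M j) ∧ M 0 = 1 ∧ Monotone M ∧
  (∀ j : ℕ, (M (j+1))^2 ≤ M j * M (j+2)) ∧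
  (∃ A : ℝ, ∀ j k : ℕ, 1 ≤ j + k →
    (M (j+k) / (M j * M k)) ^ ((1:ℝ)/((j:ℝ)+(k:ℝ))) ≤ A) ∧
  (Summable (fun j : ℕ => M j / (((j:ℝ)+1) * M (j+1))) ∧
   ∃ A : ℝ, ∀ k : ℕ,
     M (k+1) / M k * ∑' j : ℕ, M (j+k) / (((j:ℝ)+(k:ℝ)+1) * M (j+k+1)) ≤ A)

lemma growth_aux (m : ℕ → ℝ) (hm : ∀ j, 0 < m j) (hmono : Monotone m)
    (a : ℕ → ℝ) (ha : ∀ j, a j = 1 / (((j:ℝ) + 1) * m j)) (hs : Summable a)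
    (A : ℝ) (hA : ∀ k, m k * ∑' j, a (j + k) ≤ A) :
    ∃ b : ℕ, 1 ≤ b ∧ ∃ K : ℝ, 1 ≤ K ∧ ∀ j i : ℕ, j ≤ i →
      ((i:ℝ) + 1) * m j ^ b ≤ K * ((j:ℝ) + 1) * m i ^ b := by
  obtain ⟨b0, hb0⟩ := exists_nat_ge A
  set b : ℕ := b0 + 1 with hb
  have hbA : A ≤ (b:ℝ) := by rw [hb]; push_cast; linarith
  have hbpos : (1:ℝ) ≤ (b:ℝ) := by rw [hb]; push_cast; linarith [Nat.cast_nonneg (α := ℝ) b0]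
  have hapos : ∀ j, 0 < a j := fun j => by
    rw [ha]; have := hm j; positivity
  set T : ℕ → ℝ := fun k => ∑' j, a (j + k) with hT
  have hsk : ∀ k, Summable (fun j => a (j + k)) := fun k => (summable_nat_add_iff k).2 hs
  have hTnn : ∀ k, 0 ≤ T k := fun k => tsum_nonneg fun j => (hapos _).le
  have hTb : ∀ k, m k * T k ≤ b := fun k => (hA k).trans hbA
  have hTs : ∀ k, T k = a k + T (k + 1) := fun k => by
    have := (hsk k).tsum_eq_zero_add
    simp only [hT]
    rw [this]
    simp only [zero_add]
    congr 1
    refine tsum_congr fun j => ?_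
    congr 1
    ring
  -- one step decay
  have hstep : ∀ k : ℕ, T (k+1) ^ b * ((k:ℝ) + 1 + 1) ≤ T k ^ b * ((k:ℝ) + 1) := by
    intro k
    have hk : (0:ℝ) < (k:ℝ) + 1 := by positivity
    have h1 : T (k+1) ≤ T k * Real.exp (-(1 / (b * ((k:ℝ)+1)))) := by
      have e : T (k+1) = T k - a k := by rw [hTs k]; ring
      have : T k * (1 / (b * ((k:ℝ)+1))) ≤ a k := by
        rw [ha]
        rw [mul_one_div, div_le_div_iff₀ (by positivity) (by have := hm k; positivity)]
        nlinarith [hTb k]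
      have h2 := Real.one_sub_le_exp_neg (1 / (b * ((k:ℝ)+1)))
      have h3 := mul_le_mul_of_nonneg_left h2 (hTnn k)
      linarith
    have h2 : T (k+1) ^ b ≤ T k ^ b * Real.exp (-(1/((k:ℝ)+1))) := by
      refine (pow_le_pow_left₀ (hTnn _) h1 b).trans (le_of_eq ?_)
      rw [mul_pow, ← Real.exp_nat_mul]
      congr 2
      field_simp
    have h3 : Real.exp (-(1/((k:ℝ)+1))) * ((k:ℝ)+1+1) ≤ (k:ℝ)+1 := by
      have h4 := Real.add_one_le_exp (1/((k:ℝ)+1))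
      rw [Real.exp_neg, inv_mul_le_iff₀ (Real.exp_pos _)]
      calc (k:ℝ)+1+1 = (1/((k:ℝ)+1) + 1) * ((k:ℝ)+1) := by field_simp; ring
        _ ≤ _ := mul_le_mul_of_nonneg_right h4 hk.le
    calc _ ≤ T k ^ b * Real.exp (-(1/((k:ℝ)+1))) * ((k:ℝ)+1+1) :=
          mul_le_mul_of_nonneg_right h2 (by positivity)
      _ = T k ^ b * (Real.exp (-(1/((k:ℝ)+1))) * ((k:ℝ)+1+1)) := by ring
      _ ≤ _ := mul_le_mul_of_nonneg_left h3 (pow_nonneg (hTnn _) _)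
  have hanti : Antitone (fun k : ℕ => T k ^ b * ((k:ℝ) + 1)) := by
    apply antitone_nat_of_succ_le
    intro k
    have := hstep k
    push_cast
    exact this
  have hlow : ∀ i : ℕ, 1 ≤ 2 * m i * T (i / 2) := by
    intro i
    have h1 : ∑ j ∈ Finset.range (i - i/2 + 1), a (j + i/2) ≤ T (i/2) :=
      (hsk (i/2)).sum_le_tsum _ (fun j _ => (hapos _).le)
    have h2 : ∑ j ∈ Finset.range (i - i/2 + 1), (1 / (((i:ℝ)+1) * m i)) ≤
        ∑ j ∈ Finset.range (i - i/2 + 1), a (j + i/2) := by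
      refine Finset.sum_le_sum fun j hj => ?_
      rw [Finset.mem_range] at hj
      have hji : j + i/2 ≤ i := by omega
      rw [ha]
      have := hm (j + i/2)
      have h5 : ((j + i/2 : ℕ):ℝ) ≤ i := by exact_mod_cast hji
      apply one_div_le_one_div_of_le (by positivity)
      exact mul_le_mul (by linarith) (hmono hji) this.le (by positivity)
    rw [Finset.sum_const, Finset.card_range, nsmul_eq_mul] at h2
    have h3 := h2.trans h1
    have hmi := hm i
    rw [mul_one_div, div_le_iff₀ (by positivity)] at h3
    have h4 : (i:ℝ) + 1 ≤ 2 * ((i - i/2 + 1 : ℕ):ℝ) := by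
      have : i + 1 ≤ 2 * (i - i/2 + 1) := by omega
      exact_mod_cast this
    have h5 : (0:ℝ) < (i:ℝ)+1 := by positivity
    have h6 : ((i:ℝ)+1) * 1 ≤ ((i:ℝ)+1) * (2 * m i * T (i/2)) := by nlinarith
    exact le_of_mul_le_mul_left h6 h5
  refine ⟨b, by omega, 2 * (2 * b) ^ b, ?_, ?_⟩
  · have : (1:ℝ) ≤ (2 * b) ^ b := one_le_pow₀ (by linarith)
    linarith
  intro j i hji
  have hmj := hm j
  have hmi := hm i
  have hK1 : (1:ℝ) ≤ (2 * b) ^ b := one_le_pow₀ (by linarith)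
  by_cases h : j ≤ i / 2
  · have h1 := hanti h
    simp only at h1
    have h2 : T j ^ b * m j ^ b ≤ (b:ℝ)^b := by
      rw [← mul_pow]
      exact pow_le_pow_left₀ (mul_nonneg (hTnn _) hmj.le) (by linarith [hTb j]) _
    have h3 : (1:ℝ) ≤ (2 * m i) ^ b * T (i/2) ^ b := by
      rw [← mul_pow]; exact one_le_pow₀ (hlow i)
    have h4 : (i:ℝ) + 1 ≤ 2 * (((i/2 : ℕ):ℝ) + 1) := by
      have : i + 1 ≤ 2 * (i/2 + 1) := by omega
      exact_mod_cast this
    calc ((i:ℝ)+1) * m j ^ b ≤ 2 * (((i/2 : ℕ):ℝ) + 1) * m j ^ b * 1 := by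
          rw [mul_one]; exact mul_le_mul_of_nonneg_right h4 (by positivity)
      _ ≤ 2 * (((i/2 : ℕ):ℝ) + 1) * m j ^ b * ((2 * m i) ^ b * T (i/2) ^ b) :=
          mul_le_mul_of_nonneg_left h3 (by positivity)
      _ = 2 * m j ^ b * (2 * m i) ^ b * (T (i/2) ^ b * (((i/2 : ℕ):ℝ) + 1)) := by ring
      _ ≤ 2 * m j ^ b * (2 * m i) ^ b * (T j ^ b * ((j:ℝ)+1)) :=
          mul_le_mul_of_nonneg_left h1 (by positivity)
      _ = 2 * (2 * m i) ^ b * ((j:ℝ)+1) * (T j ^ b * m j ^ b) := by ring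
      _ ≤ 2 * (2 * m i) ^ b * ((j:ℝ)+1) * (b:ℝ)^b :=
          mul_le_mul_of_nonneg_left h2 (by positivity)
      _ = _ := by rw [mul_pow, mul_pow]; ring
  · have h4 : (i:ℝ) + 1 ≤ 2 * ((j:ℝ) + 1) := by
      have : i + 1 ≤ 2 * (j + 1) := by omega
      exact_mod_cast this
    have h5 : m j ^ b ≤ m i ^ b := pow_le_pow_left₀ hmj.le (hmono hji) _
    calc ((i:ℝ)+1) * m j ^ b ≤ (2 * ((j:ℝ) + 1)) * m i ^ b := by
          exact mul_le_mul h4 h5 (by positivity) (by positivity)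
      _ ≤ (2 * ((j:ℝ) + 1)) * m i ^ b * (2 * b) ^ b :=
          le_mul_of_one_le_right (by positivity) hK1
      _ = _ := by ring

/-- Incomplete-Gamma type cut-off. -/
def cutX (N : ℕ) (u : ℂ) : ℂ :=
  1 - Complex.exp (-u) * ∑ k ∈ Finset.range N, u ^ k / (Nat.factorial k : ℂ)

lemma cutX_sub_one (N : ℕ) (u : ℂ) (hu : ‖u‖ / 2 ≤ u.re) :
    ‖cutX N u - 1‖ ≤ 4 ^ N * Real.exp (-(‖u‖ / 4)) := by
  have h1 : ‖cutX N u - 1‖ = Real.exp (-u.re) *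
      ‖∑ k ∈ Finset.range N, u ^ k / (Nat.factorial k : ℂ)‖ := by
    rw [cutX, sub_sub_cancel_left, norm_neg, norm_mul, Complex.norm_exp, Complex.neg_re]
  have h2 : ‖∑ k ∈ Finset.range N, u ^ k / (Nat.factorial k : ℂ)‖ ≤
      4 ^ N * Real.exp (‖u‖/4) := by
    calc _ ≤ ∑ k ∈ Finset.range N, ‖u ^ k / (Nat.factorial k : ℂ)‖ := norm_sum_le _ _
      _ ≤ ∑ k ∈ Finset.range N, 4 ^ N * ((‖u‖/4)^k / (Nat.factorial k : ℝ)) := by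
          refine Finset.sum_le_sum fun k hk => ?_
          rw [Finset.mem_range] at hk
          rw [norm_div, norm_pow, Complex.norm_natCast, ← mul_div_assoc]
          apply div_le_div_of_nonneg_right _ (by positivity)
          calc ‖u‖^k = 4^k * (‖u‖/4)^k := by rw [← mul_pow]; congr 1; ring
            _ ≤ _ := mul_le_mul_of_nonneg_right
                  (pow_le_pow_right₀ (by norm_num) hk.le) (by positivity)
      _ = 4 ^ N * ∑ k ∈ Finset.range N, ((‖u‖/4)^k / (Nat.factorial k : ℝ)) := by
          rw [Finset.mul_sum]
      _ ≤ _ := mul_le_mul_of_nonneg_left (Real.sum_le_exp_of_nonneg (by positivity) N)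
            (by positivity)
  rw [h1]
  calc _ ≤ Real.exp (-(‖u‖/2)) * (4 ^ N * Real.exp (‖u‖/4)) :=
        mul_le_mul (Real.exp_le_exp.2 (by linarith)) h2 (norm_nonneg _) (Real.exp_pos _).le
    _ = 4 ^ N * (Real.exp (-(‖u‖/2)) * Real.exp (‖u‖/4)) := by ring
    _ = _ := by rw [← Real.exp_add]; congr 2; ring

lemma cutX_le (N : ℕ) (hN : 1 ≤ N) (u : ℂ) (hu : ‖u‖ / 2 ≤ u.re) :
    ‖cutX N u‖ ≤ 5 ^ N := by
  have h1 := cutX_sub_one N u hu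
  have h2 : Real.exp (-(‖u‖ / 4)) ≤ 1 := Real.exp_le_one_iff.2 (by linarith [norm_nonneg u])
  have h3 : ‖cutX N u‖ ≤ ‖cutX N u - 1‖ + 1 := by
    have := norm_add_le (cutX N u - 1) 1
    simpa using this
  have h4 : (4:ℝ)^N + 1 ≤ 5^N := by
    have := pow_add_pow_le (x := (4:ℝ)) (y := 1) (by norm_num) (by norm_num) (n := N) (by omega)
    norm_num at this
    exact this
  have : (4:ℝ)^N * Real.exp (-(‖u‖ / 4)) ≤ 4^N := mul_le_of_le_one_right (by positivity) h2
  linarith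

lemma exp_tail (N : ℕ) (t : ℝ) (ht : 0 ≤ t) (ht1 : t ≤ 1) :
    Real.exp (N * t) - ∑ k ∈ Finset.range N, (N * t) ^ k / (Nat.factorial k : ℝ)
      ≤ t ^ N * Real.exp N := by
  have hE : ∀ x : ℝ, HasSum (fun n : ℕ => x ^ n / (Nat.factorial n : ℝ)) (Real.exp x) := by
    intro x
    have := NormedSpace.expSeries_div_hasSum_exp (𝔸 := ℝ) x
    rwa [← Real.exp_eq_exp_ℝ] at this
  have h1 := (hE (N * t)).summable.sum_add_tsum_nat_add N
  have h1' := (hE N).summable.sum_add_tsum_nat_add N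
  rw [(hE _).tsum_eq] at h1 h1'
  have h2 : 0 ≤ ∑ k ∈ Finset.range N, (N:ℝ) ^ k / (Nat.factorial k : ℝ) :=
    Finset.sum_nonneg fun k _ => by positivity
  have h3 : ∑' i, (N * t) ^ (i + N) / (Nat.factorial (i + N) : ℝ) ≤
      ∑' i, t ^ N * ((N:ℝ) ^ (i + N) / (Nat.factorial (i + N) : ℝ)) := by
    refine Summable.tsum_le_tsum (fun i => ?_) ((summable_nat_add_iff N).2 (hE (N*t)).summable)
      (((summable_nat_add_iff N).2 (hE N).summable).mul_left _)
    rw [mul_pow, ← mul_div_assoc]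
    apply div_le_div_of_nonneg_right _ (by positivity)
    rw [mul_comm]
    exact mul_le_mul_of_nonneg_right (pow_le_pow_of_le_one ht ht1 (by omega)) (by positivity)
  rw [tsum_mul_left] at h3
  have h4 : t ^ N * ∑' i, ((N:ℝ) ^ (i + N) / (Nat.factorial (i + N) : ℝ)) ≤
     t ^ N * Real.exp N := mul_le_mul_of_nonneg_left (by linarith) (by positivity)
  linarith

lemma cutX_le' (N : ℕ) (u : ℂ) (hu : ‖u‖ / 2 ≤ u.re) (t : ℝ) (ht : 0 ≤ t)
    (ht1 : t ≤ 1) (hut : ‖u‖ = N * t) :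
    ‖cutX N u‖ ≤ 5 ^ N * t ^ N := by
  have h1 : cutX N u = Complex.exp (-u) *
      (Complex.exp u - ∑ k ∈ Finset.range N, u ^ k / (Nat.factorial k : ℂ)) := by
    rw [cutX, mul_sub, ← Complex.exp_add]; simp
  have h2 := Complex.norm_exp_sub_sum_le_exp_norm_sub_sum u N
  rw [hut] at h2
  have h3 := h2.trans (exp_tail N t ht ht1)
  have h4 : ‖Complex.exp (-u)‖ ≤ 1 := by
    rw [Complex.norm_exp, Real.exp_le_one_iff, Complex.neg_re]
    linarith [norm_nonneg u]
  rw [h1, norm_mul]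
  have h5 : Real.exp N ≤ 5 ^ N := by
    have : Real.exp (N:ℝ) = Real.exp 1 ^ N := by rw [← Real.exp_nat_mul, mul_one]
    rw [this]
    exact pow_le_pow_left₀ (Real.exp_pos _).le (by linarith [Real.exp_one_lt_d9]) _
  calc _ ≤ 1 * (t ^ N * Real.exp N) := mul_le_mul h4 h3 (norm_nonneg _) zero_le_one
    _ = Real.exp N * t ^ N := by ring
    _ ≤ _ := mul_le_mul_of_nonneg_right h5 (by positivity)

/-- An open cone around the positive real axis. -/
def coneS (s : ℝ) : Set ℂ := {w | ∃ ρ : ℝ, 0 < ρ ∧ ‖w - (ρ:ℂ)‖ < s * ρ}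

lemma isOpen_coneS (s : ℝ) : IsOpen (coneS s) := by
  have : coneS s = ⋃ ρ : ℝ, {w : ℂ | 0 < ρ ∧ ‖w - (ρ:ℂ)‖ < s * ρ} := by
    ext w; simp [coneS]
  rw [this]
  refine isOpen_iUnion fun ρ => ?_
  by_cases h : 0 < ρ
  · simp only [h, true_and]
    exact isOpen_lt (by fun_prop) (by fun_prop)
  · simp [h]

lemma cone_re (b : ℕ) : ∃ s : ℝ, 0 < s ∧ s ≤ 1 ∧ ∀ w ∈ coneS s, w ≠ 0 ∧
    ∀ r : ℝ, 0 < r → ‖((r:ℂ) / w) ^ b‖ / 2 ≤ (((r:ℂ) / w) ^ b).re := by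
  have hc : ContinuousAt (fun q : ℂ => q ^ b) 1 := by fun_prop
  obtain ⟨d, hd, h⟩ := Metric.continuousAt_iff.1 hc (1/3) (by norm_num)
  refine ⟨min d 1, by positivity, min_le_right _ _, ?_⟩
  rintro w ⟨ρ, hρ, hw⟩
  have hw0 : w ≠ 0 := by
    rintro rfl
    rw [zero_sub, norm_neg, Complex.norm_real, Real.norm_of_nonneg hρ.le] at hw
    have : min d 1 * ρ ≤ 1 * ρ := mul_le_mul_of_nonneg_right (min_le_right _ _) hρ.le
    linarith
  refine ⟨hw0, fun r hr => ?_⟩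
  have hρ0 : (ρ:ℂ) ≠ 0 := by exact_mod_cast hρ.ne'
  set q : ℂ := w / ρ with hq
  have hqd : dist q 1 < d := by
    have : q - 1 = (w - ρ) / ρ := by rw [hq]; field_simp
    rw [dist_eq_norm, this, norm_div, Complex.norm_real, Real.norm_of_nonneg hρ.le,
      div_lt_iff₀ hρ]
    exact hw.trans_le (mul_le_mul_of_nonneg_right (min_le_left _ _) hρ.le)
  have h1 := h hqd
  simp only [one_pow, dist_eq_norm] at h1
  set Q : ℂ := q ^ b with hQ
  have hre : 1 - 1/3 ≤ Q.re := by
    have := (Complex.abs_re_le_norm (Q - 1)).trans h1.le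
    rw [Complex.sub_re, Complex.one_re, abs_le] at this
    linarith
  have hno : ‖Q‖ ≤ 1 + 1/3 := by
    have := norm_add_le (Q - 1) 1
    rw [sub_add_cancel, norm_one] at this
    linarith
  have hkey : ((r:ℂ) / w) ^ b = (((r / ρ) ^ b : ℝ) : ℂ) * Q⁻¹ := by
    rw [hQ, hq]; push_cast; rw [← inv_pow, ← mul_pow]; congr 1; field_simp
  have hc0 : 0 ≤ (r / ρ) ^ b := by positivity
  rw [hkey, norm_mul, Complex.norm_real, Real.norm_of_nonneg hc0, Complex.re_ofReal_mul,
    mul_div_assoc]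
  apply mul_le_mul_of_nonneg_left _ hc0
  rw [norm_inv, Complex.inv_re, Complex.normSq_eq_norm_sq]
  have hQ0 : 0 < ‖Q‖ := by
    have := Complex.re_le_norm Q
    linarith
  rw [le_div_iff₀ (by positivity)]
  have : ‖Q‖⁻¹ / 2 * ‖Q‖ ^ 2 = ‖Q‖ / 2 := by field_simp
  rw [this]; linarith

/-- Combinatorial consequence of the growth condition. -/
lemma growth_prod (M : ℕ → ℝ) (hMp : ∀ j, 0 < M j) (b : ℕ) (K : ℝ)
    (hK : ∀ j i : ℕ, j ≤ i →
      ((i:ℝ) + 1) * (M (j+1) / M j) ^ b ≤ K * ((j:ℝ) + 1) * (M (i+1) / M i) ^ b)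
    (hK1 : 1 ≤ K) (j p : ℕ) :
    M j ^ b * (M (j+1) / M j) ^ (b * p) * (Nat.factorial p : ℝ) ≤
      K ^ p * ((j:ℝ) + 1) ^ p * M (j + p) ^ b := by
  induction p with
  | zero => simp
  | succ p ih =>
    have hmj : 0 < M (j+1) / M j := div_pos (hMp _) (hMp _)
    have h1 : ((p:ℝ) + 1) * (M (j+1) / M j) ^ b ≤
        K * ((j:ℝ) + 1) * (M (j+p+1) / M (j+p)) ^ b := by
      refine le_trans ?_ (hK j (j+p) (by omega))
      apply mul_le_mul_of_nonneg_right _ (by positivity)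
      push_cast; linarith [Nat.cast_nonneg (α := ℝ) j]
    have h2 : M (j+p+1) = M (j+p) * (M (j+p+1) / M (j+p)) := by
      have := (hMp (j+p)).ne'
      field_simp
    have hp := hMp (j+p)
    have hj := hMp j
    calc M j ^ b * (M (j+1) / M j) ^ (b * (p+1)) * ((p+1).factorial : ℝ)
        = (M j ^ b * (M (j+1) / M j) ^ (b * p) * (Nat.factorial p : ℝ)) *
          (((p:ℝ) + 1) * (M (j+1) / M j) ^ b) := by
            rw [Nat.factorial_succ]; push_cast; ring
      _ ≤ (K ^ p * ((j:ℝ) + 1) ^ p * M (j + p) ^ b) *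
          (K * ((j:ℝ) + 1) * (M (j+p+1) / M (j+p)) ^ b) :=
            mul_le_mul ih h1 (by positivity) (by positivity)
      _ = K ^ (p+1) * ((j:ℝ) + 1) ^ (p+1) * (M (j+p) * (M (j+p+1) / M (j+p))) ^ b := by
            rw [mul_pow (M (j+p))]; ring
      _ = _ := by rw [← h2]; rfl

/-- The exponentially small factor is controlled by `M`. -/
lemma exp_M_bound (M : ℕ → ℝ) (hMp : ∀ j, 0 < M j) (b : ℕ) (hb : 1 ≤ b) (K : ℝ)
    (hK : ∀ j i : ℕ, j ≤ i →
      ((i:ℝ) + 1) * (M (j+1) / M j) ^ b ≤ K * ((j:ℝ) + 1) * (M (i+1) / M i) ^ b)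
    (hK1 : 1 ≤ K) (j p : ℕ) (x : ℝ) (hx : 0 ≤ x) :
    M j * (M (j+1) / M j) ^ p * x ^ p * Real.exp (-(((j:ℝ)+1) * x ^ b / 4)) ≤
      (4 * K) ^ p * M (j + p) := by
  have hmj : 0 < M (j+1) / M j := div_pos (hMp _) (hMp _)
  have hj := hMp j
  have hjp := hMp (j+p)
  have hfac : (0:ℝ) < (Nat.factorial p : ℝ) := by positivity
  rw [← pow_le_pow_iff_left₀ (by positivity) (by positivity) (show b ≠ 0 by omega)]
  set y := x ^ b with hy
  have hy0 : 0 ≤ y := by positivity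
  set E := Real.exp (-(((j:ℝ)+1) * y / 4)) with hE
  have hEb : (((j:ℝ)+1) * y / 4) ^ p * E ^ b ≤ (Nat.factorial p : ℝ) := by
    have h1 : E ^ b ≤ E := pow_le_of_le_one (Real.exp_pos _).le
      (Real.exp_le_one_iff.2 (by simp only [neg_nonpos]; positivity)) (by omega)
    have h2 := Real.pow_div_factorial_le_exp (((j:ℝ)+1) * y / 4) (by positivity) p
    rw [div_le_iff₀ hfac] at h2
    calc _ ≤ (((j:ℝ)+1) * y / 4) ^ p * E := mul_le_mul_of_nonneg_left h1 (by positivity)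
      _ ≤ (Real.exp (((j:ℝ)+1) * y / 4) * (Nat.factorial p : ℝ)) * E :=
          mul_le_mul_of_nonneg_right h2 (Real.exp_pos _).le
      _ = (Nat.factorial p : ℝ) * (Real.exp (((j:ℝ)+1) * y / 4) * E) := by ring
      _ = _ := by rw [hE, ← Real.exp_add]; simp
  have hG := growth_prod M hMp b K hK hK1 j p
  have hj1 : (0:ℝ) < ((j:ℝ)+1)^p := by positivity
  have h3 : (M j * (M (j+1) / M j) ^ p * x ^ p * E) ^ b * ((j:ℝ)+1)^p ≤
      (4 ^ p * K ^ p * M (j+p) ^ b) * ((j:ℝ)+1)^p := by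
    calc (M j * (M (j+1) / M j) ^ p * x ^ p * E) ^ b * ((j:ℝ)+1)^p
        = 4 ^ p * (M j ^ b * (M (j+1) / M j) ^ (b * p)) * ((((j:ℝ)+1) * y / 4) ^ p * E ^ b) := by
          rw [hy]
          generalize M (j+1) / M j = q
          simp only [mul_pow, div_pow, ← pow_mul]
          rw [mul_comm b p]
          field_simp
      _ ≤ 4 ^ p * (M j ^ b * (M (j+1) / M j) ^ (b * p)) * (Nat.factorial p : ℝ) :=
          mul_le_mul_of_nonneg_left hEb (by positivity)
      _ = 4 ^ p * (M j ^ b * (M (j+1) / M j) ^ (b * p) * (Nat.factorial p : ℝ)) := by ring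
      _ ≤ 4 ^ p * (K ^ p * ((j:ℝ) + 1) ^ p * M (j + p) ^ b) :=
          mul_le_mul_of_nonneg_left hG (by positivity)
      _ = _ := by ring
  refine (le_of_mul_le_mul_right h3 hj1).trans ?_
  rw [mul_pow ((4*K)^p), ← mul_pow]
  apply mul_le_mul_of_nonneg_right _ (by positivity)
  exact le_self_pow₀ (one_le_pow₀ (by linarith)) (by omega)

lemma M_le (M : ℕ → ℝ) (hMp : ∀ j, 0 < M j) (hmono : Monotone (fun j => M (j+1) / M j))
    (n p : ℕ) : M (n + p) ≤ M n * (M (n+p+1) / M (n+p)) ^ p := by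
  induction p with
  | zero => simp
  | succ p ih =>
    have h1 : M (n+p+1) / M (n+p) ≤ M (n+(p+1)+1) / M (n+(p+1)) := hmono (by omega)
    have h0 : 0 < M (n+p+1) / M (n+p) := div_pos (hMp _) (hMp _)
    have hn := hMp n
    have h2 : M (n+(p+1)) = M (n+p) * (M (n+p+1) / M (n+p)) := by
      have := (hMp (n+p)).ne'
      rw [← add_assoc]; field_simp
    calc M (n+(p+1)) = M (n+p) * (M (n+p+1) / M (n+p)) := h2
      _ ≤ M n * (M (n+p+1) / M (n+p)) ^ p * (M (n+p+1) / M (n+p)) :=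
          mul_le_mul_of_nonneg_right ih h0.le
      _ = M n * (M (n+p+1) / M (n+p)) ^ (p+1) := by ring
      _ ≤ _ := mul_le_mul_of_nonneg_left (pow_le_pow_left₀ h0.le h1 _) hn.le

/-- The terms of the series. -/
def brTerm (M : ℕ → ℝ) (F : ℕ → ℂ) (σ : ℝ) (b j : ℕ) (w : ℂ) : ℂ :=
  F j * w ^ j * cutX (j+1)
    (((j:ℂ)+1) * (((1 / (10 * σ * (M (j+1) / M j)) : ℝ) : ℂ) / w) ^ b)

section
variable (M : ℕ → ℝ) (hMp : ∀ j, 0 < M j) (hmono : Monotone (fun j => M (j+1) / M j))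
  (b : ℕ) (hb : 1 ≤ b) (F : ℕ → ℂ) (C σ : ℝ) (hC : 0 < C) (hσ : 0 < σ)
  (hF : ∀ j : ℕ, ‖F j‖ ≤ C * σ ^ j * M j)
  (w : ℂ) (hw0 : w ≠ 0)
  (hw : ∀ r : ℝ, 0 < r → ‖((r:ℂ) / w) ^ b‖ / 2 ≤ (((r:ℂ) / w) ^ b).re)
include hMp hσ hw

lemma u_re (j : ℕ) (r : ℝ) (hr : 0 < r) :
    ‖((j:ℂ)+1) * ((r:ℂ) / w) ^ b‖ / 2 ≤ (((j:ℂ)+1) * ((r:ℂ) / w) ^ b).re ∧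
    ‖((j:ℂ)+1) * ((r:ℂ) / w) ^ b‖ = ((j+1 : ℕ):ℝ) * (r / ‖w‖) ^ b := by
  have h := hw r hr
  have e : ((j:ℂ)+1) = (((j+1 : ℕ):ℝ):ℂ) := by push_cast; rfl
  have hn : ‖((r:ℂ) / w) ^ b‖ = (r / ‖w‖) ^ b := by
    rw [norm_pow, norm_div, Complex.norm_real, Real.norm_of_nonneg hr.le]
  rw [e, norm_mul, Complex.norm_real, Complex.re_ofReal_mul,
    Real.norm_of_nonneg (by positivity)]
  refine ⟨?_, by rw [hn]⟩
  rw [mul_div_assoc]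
  exact mul_le_mul_of_nonneg_left h (by positivity)

include hmono hb hC hF hw0

lemma term_high (n p : ℕ) :
    ‖brTerm M F σ b (n+p) w‖ ≤
      (5 * C * (10 * σ) ^ n * M n * ‖w‖ ^ n) * (1/2) ^ (n+p) := by
  set j := n + p with hj
  have hm : 0 < M (j+1) / M j := div_pos (hMp _) (hMp _)
  set m := M (j+1) / M j with hmd
  set r : ℝ := 1 / (10 * σ * m) with hr
  have hr0 : 0 < r := by positivity
  have hwn : 0 < ‖w‖ := norm_pos_iff.2 hw0
  obtain ⟨h1, h2⟩ := u_re M hMp b σ hσ w hw j r hr0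
  have hX : ‖w‖ ^ j * ‖cutX (j+1) (((j:ℂ)+1) * ((r:ℂ) / w) ^ b)‖ ≤
      5 ^ (j+1) * (‖w‖ ^ n * r ^ p) := by
    by_cases hc : ‖w‖ ≤ r
    · have := cutX_le (j+1) (by omega) _ h1
      calc _ ≤ ‖w‖ ^ j * 5 ^ (j+1) := mul_le_mul_of_nonneg_left this (by positivity)
        _ = 5 ^ (j+1) * (‖w‖ ^ n * ‖w‖ ^ p) := by rw [hj]; ring
        _ ≤ _ := by gcongr
    · push Not at hc
      have ht0 : 0 ≤ r / ‖w‖ := by positivity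
      have ht1 : r / ‖w‖ ≤ 1 := by rw [div_le_one hwn]; exact hc.le
      have := cutX_le' (j+1) _ h1 ((r / ‖w‖)^b) (by positivity) (pow_le_one₀ ht0 ht1) h2
      have h3 : ((r / ‖w‖)^b) ^ (j+1) ≤ (r / ‖w‖) ^ p := by
        rw [← pow_mul]
        apply pow_le_pow_of_le_one ht0 ht1
        nlinarith
      calc _ ≤ ‖w‖ ^ j * (5 ^ (j+1) * (r / ‖w‖) ^ p) := by
            apply mul_le_mul_of_nonneg_left _ (by positivity)
            exact this.trans (mul_le_mul_of_nonneg_left h3 (by positivity))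
        _ = _ := by rw [hj, div_pow, pow_add ‖w‖]; field_simp
  have hMle := M_le M hMp hmono n p
  rw [← hj, ← hmd] at hMle
  have hMn := hMp n
  rw [brTerm, norm_mul, norm_mul, norm_pow, mul_assoc]
  calc _ ≤ (C * σ ^ j * M j) * (5 ^ (j+1) * (‖w‖ ^ n * r ^ p)) :=
        mul_le_mul (hF j) hX (by positivity) ((norm_nonneg _).trans (hF j))
    _ ≤ (C * σ ^ j * (M n * m ^ p)) * (5 ^ (j+1) * (‖w‖ ^ n * r ^ p)) := by gcongr
    _ = (5 * C * (10 * σ) ^ n * M n * ‖w‖ ^ n) * (1/2) ^ j := by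
        have e1 : r ^ p * m ^ p * (10 * σ) ^ p = 1 := by
          rw [← mul_pow, ← mul_pow, hr]
          have : 1 / (10 * σ * m) * m * (10 * σ) = 1 := by field_simp
          rw [this, one_pow]
        have e2 : (5:ℝ) ^ (j+1) * σ ^ j = 5 * (10 * σ) ^ n * (10 * σ) ^ p * (1/2) ^ j := by
          rw [mul_assoc, mul_assoc, ← mul_assoc ((10 * σ)^n), ← pow_add, ← hj, ← mul_pow,
            pow_succ, mul_comm _ (5:ℝ), mul_assoc, ← mul_pow]
          congr 2; ring
        calc _ = C * M n * ‖w‖ ^ n * (r ^ p * m ^ p) * ((5:ℝ) ^ (j+1) * σ ^ j) := by ring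
          _ = C * M n * ‖w‖ ^ n * 5 * (10 * σ) ^ n * (1/2) ^ j *
              (r ^ p * m ^ p * (10 * σ) ^ p) := by rw [e2]; ring
          _ = _ := by rw [e1]; ring

lemma term_low (K : ℝ) (hK1 : 1 ≤ K) (hK : ∀ j i : ℕ, j ≤ i →
      ((i:ℝ) + 1) * (M (j+1) / M j) ^ b ≤ K * ((j:ℝ) + 1) * (M (i+1) / M i) ^ b)
    (j p : ℕ) :
    ‖brTerm M F σ b j w - F j * w ^ j‖ ≤
      4 * C * (40 * K * σ) ^ (j+p) * M (j+p) * ‖w‖ ^ (j+p) := by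
  have hm : 0 < M (j+1) / M j := div_pos (hMp _) (hMp _)
  have hE := exp_M_bound M hMp b hb K hK hK1 j p
  set m := M (j+1) / M j with hmd
  set r : ℝ := 1 / (10 * σ * m) with hr
  have hr0 : 0 < r := by positivity
  have hwn : 0 < ‖w‖ := norm_pos_iff.2 hw0
  obtain ⟨h1, h2⟩ := u_re M hMp b σ hσ w hw j r hr0
  have h3 := cutX_sub_one (j+1) _ h1
  rw [h2] at h3
  have hE' := hE (r / ‖w‖) (by positivity)
  have e0 : m ^ p * (r / ‖w‖) ^ p * ((10 * σ) ^ p * ‖w‖ ^ p) = 1 := by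
    rw [← mul_pow, ← mul_pow, ← mul_pow]
    have : m * (r / ‖w‖) * (10 * σ * ‖w‖) = 1 := by rw [hr]; field_simp
    rw [this, one_pow]
  set E := Real.exp (-(((j:ℝ)+1) * (r / ‖w‖) ^ b / 4)) with hEd
  have hE0 : 0 < E := Real.exp_pos _
  have h4 : M j * E ≤ (40 * K * σ) ^ p * M (j+p) * ‖w‖ ^ p := by
    calc M j * E = (M j * m ^ p * (r / ‖w‖) ^ p * E) * ((10 * σ) ^ p * ‖w‖ ^ p) := by
          linear_combination (-(M j * E)) * e0
      _ ≤ ((4 * K) ^ p * M (j+p)) * ((10 * σ) ^ p * ‖w‖ ^ p) :=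
          mul_le_mul_of_nonneg_right hE' (by positivity)
      _ = ((4 * K) * (10 * σ)) ^ p * M (j+p) * ‖w‖ ^ p := by rw [mul_pow (4 * K)]; ring
      _ = _ := by congr 3; ring
  have h3' : ‖cutX (j+1) (((j:ℂ)+1) * ((r:ℂ) / w) ^ b) - 1‖ ≤ 4 ^ (j+1) * E := by
    rw [hEd]; push_cast at h3; exact h3
  have e1 : brTerm M F σ b j w - F j * w ^ j =
      F j * (w ^ j * (cutX (j+1) (((j:ℂ)+1) * ((r:ℂ) / w) ^ b) - 1)) := by
    rw [brTerm]; ring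
  have hMjp := hMp (j+p)
  rw [e1, norm_mul, norm_mul, norm_pow]
  calc _ ≤ (C * σ ^ j * M j) * (‖w‖ ^ j * (4 ^ (j+1) * E)) :=
        mul_le_mul (hF j) (mul_le_mul_of_nonneg_left h3' (by positivity)) (by positivity)
          ((norm_nonneg _).trans (hF j))
    _ = 4 * C * (4 * σ) ^ j * ‖w‖ ^ j * (M j * E) := by rw [mul_pow]; ring
    _ ≤ 4 * C * (40 * K * σ) ^ j * ‖w‖ ^ j * ((40 * K * σ) ^ p * M (j+p) * ‖w‖ ^ p) := by
        have : 4 * σ ≤ 40 * K * σ := by nlinarith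
        have hMj := hMp j
        gcongr
    _ = _ := by rw [pow_add, pow_add ‖w‖]; ring

lemma remainder (K : ℝ) (hK1 : 1 ≤ K) (hK : ∀ j i : ℕ, j ≤ i →
      ((i:ℝ) + 1) * (M (j+1) / M j) ^ b ≤ K * ((j:ℝ) + 1) * (M (i+1) / M i) ^ b)
    (n : ℕ) :
    ‖(∑' j, brTerm M F σ b j w) - ∑ k ∈ Finset.range n, F k * w ^ k‖ ≤
      14 * C * (80 * K * σ) ^ n * M n * ‖w‖ ^ n := by
  have hhigh := term_high M hMp hmono b hb F C σ hC hσ hF w hw0 hw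
  have hlow := term_low M hMp hmono b hb F C σ hC hσ hF w hw0 hw K hK1 hK
  have hgeo : Summable (fun i : ℕ => (1/2 : ℝ) ^ i) := summable_geometric_two
  have hsum : Summable (fun j => brTerm M F σ b j w) := by
    refine Summable.of_norm_bounded (hgeo.mul_left (5 * C * (10 * σ) ^ 0 * M 0 * ‖w‖ ^ 0)) ?_
    intro j
    have := hhigh 0 j
    rwa [zero_add] at this
  have hMn := hMp n
  rw [← hsum.sum_add_tsum_nat_add n, add_sub_right_comm, ← Finset.sum_sub_distrib]
  have hA : ‖∑ k ∈ Finset.range n, (brTerm M F σ b k w - F k * w ^ k)‖ ≤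
      4 * C * (80 * K * σ) ^ n * M n * ‖w‖ ^ n := by
    calc _ ≤ ∑ k ∈ Finset.range n, ‖brTerm M F σ b k w - F k * w ^ k‖ := norm_sum_le _ _
      _ ≤ ∑ k ∈ Finset.range n, 4 * C * (40 * K * σ) ^ n * M n * ‖w‖ ^ n := by
          refine Finset.sum_le_sum fun k hk => ?_
          rw [Finset.mem_range] at hk
          have := hlow k (n - k)
          rwa [Nat.add_sub_cancel' hk.le] at this
      _ = n * (4 * C * (40 * K * σ) ^ n * M n * ‖w‖ ^ n) := by
          rw [Finset.sum_const, Finset.card_range, nsmul_eq_mul]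
      _ ≤ 2 ^ n * (4 * C * (40 * K * σ) ^ n * M n * ‖w‖ ^ n) := by
          have : (n:ℝ) ≤ 2 ^ n := by exact_mod_cast Nat.lt_two_pow_self.le
          gcongr
      _ = 4 * C * (2 * (40 * K * σ)) ^ n * M n * ‖w‖ ^ n := by rw [mul_pow 2]; ring
      _ = _ := by congr 4; ring
  have hB : ‖∑' i, brTerm M F σ b (i + n) w‖ ≤ 10 * C * (80 * K * σ) ^ n * M n * ‖w‖ ^ n := by
    have h1 : ‖∑' i, brTerm M F σ b (i + n) w‖ ≤
        (5 * C * (10 * σ) ^ n * M n * ‖w‖ ^ n) * 2 := by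
      refine tsum_of_norm_bounded (hasSum_geometric_two.mul_left _) fun i => ?_
      have := hhigh n i
      rw [add_comm n i] at this
      refine this.trans (mul_le_mul_of_nonneg_left ?_ (by positivity))
      exact pow_le_pow_of_le_one (by norm_num) (by norm_num) (by omega)
    refine h1.trans ?_
    have : 10 * σ ≤ 80 * K * σ := by nlinarith
    calc _ = 10 * C * (10 * σ) ^ n * M n * ‖w‖ ^ n := by ring
      _ ≤ _ := by gcongr
  refine (norm_add_le _ _).trans ((add_le_add hA hB).trans (le_of_eq ?_))
  ring

end

lemma poly_iter (F : ℕ → ℂ) (n k : ℕ) (z : ℂ) :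
    iteratedDeriv n (fun w : ℂ => ∑ i ∈ Finset.range k, F i * w ^ i) z =
      ∑ i ∈ Finset.range k, F i * ((i.descFactorial n : ℂ) * z ^ (i - n)) := by
  rw [iteratedDeriv_fun_sum (fun i _ => by fun_prop)]
  refine Finset.sum_congr rfl fun i _ => ?_
  rw [iteratedDeriv_const_mul_field, iteratedDeriv_pow]

lemma poly_iter_zero (F : ℕ → ℂ) (n : ℕ) (z : ℂ) :
    iteratedDeriv n (fun w : ℂ => ∑ i ∈ Finset.range n, F i * w ^ i) z = 0 := by
  rw [poly_iter]
  refine Finset.sum_eq_zero fun i hi => ?_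
  rw [Finset.mem_range] at hi
  rw [Nat.descFactorial_eq_zero_iff_lt.2 hi]; simp

lemma poly_iter_top (F : ℕ → ℂ) (n : ℕ) (z : ℂ) :
    iteratedDeriv n (fun w : ℂ => ∑ i ∈ Finset.range (n+1), F i * w ^ i) z =
      (Nat.factorial n : ℂ) * F n := by
  rw [poly_iter, Finset.sum_range_succ, Finset.sum_eq_zero, Nat.descFactorial_self]
  · simp [mul_comm]
  · intro i hi
    rw [Finset.mem_range] at hi
    rw [Nat.descFactorial_eq_zero_iff_lt.2 hi]; simp

lemma sector_ball (s γ : ℝ) (hs : 0 < s) (hγ : γ < s / 4) (z : ℂ) (hz : z ∈ Sector γ ⊤) :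
    Metric.closedBall z (s / 2 * ‖z‖) ⊆ coneS s := by
  obtain ⟨hz0, harg, -⟩ := hz
  have hzn : 0 < ‖z‖ := norm_pos_iff.2 hz0
  intro w hw
  rw [Metric.mem_closedBall, dist_eq_norm] at hw
  refine ⟨‖z‖, hzn, ?_⟩
  have h1 : ‖z - (‖z‖:ℂ)‖ ≤ ‖z‖ * |z.arg| := by
    have e : z - (‖z‖:ℂ) = (‖z‖:ℂ) * (Complex.exp (Complex.I * (z.arg : ℂ)) - 1) := by
      rw [mul_sub, mul_comm Complex.I, Complex.norm_mul_exp_arg_mul_I, mul_one]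
    rw [e, norm_mul, Complex.norm_real, norm_norm]
    exact mul_le_mul_of_nonneg_left Real.norm_exp_I_mul_ofReal_sub_one_le hzn.le
  have h2 : |z.arg| < s / 2 := by
    nlinarith [Real.pi_pos, Real.pi_lt_four]
  have h3 : ‖w - (‖z‖:ℂ)‖ ≤ ‖w - z‖ + ‖z - (‖z‖:ℂ)‖ := norm_sub_le_norm_sub_add_norm_sub _ _ _
  nlinarith

lemma cauchy_rem (f P : ℂ → ℂ) (s γ : ℝ) (hs : 0 < s) (hs1 : s ≤ 1) (hγ : γ < s / 4)
    (hf : DifferentiableOn ℂ f (coneS s)) (hP : Differentiable ℂ P) (n k : ℕ) (B : ℝ)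
    (hB : ∀ w ∈ coneS s, ‖f w - P w‖ ≤ B * ‖w‖ ^ k) (hB0 : 0 ≤ B)
    (z : ℂ) (hz : z ∈ Sector γ ⊤) :
    ‖iteratedDeriv n f z - iteratedDeriv n P z‖ ≤
      (Nat.factorial n : ℝ) * (B * (2 * ‖z‖) ^ k) / (s / 2 * ‖z‖) ^ n := by
  have hsub := sector_ball s γ hs hγ z hz
  have hzn : 0 < ‖z‖ := norm_pos_iff.2 hz.1
  have hR : 0 < s / 2 * ‖z‖ := by positivity
  have hzc : z ∈ coneS s := hsub (Metric.mem_closedBall_self hR.le)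
  have hfa : ContDiffAt ℂ n f z :=
    (hf.analyticAt ((isOpen_coneS s).mem_nhds hzc)).contDiffAt
  have hPa : ContDiffAt ℂ n P z := hP.contDiff.contDiffAt
  rw [← iteratedDeriv_fun_sub hfa hPa]
  refine Complex.norm_iteratedDeriv_le_of_forall_mem_sphere_norm_le n hR ?_ ?_
  · refine DifferentiableOn.diffContOnCl ?_
    rw [closure_ball _ hR.ne']
    exact (hf.mono hsub).sub hP.differentiableOn
  · intro w hw
    refine (hB w (hsub (Metric.sphere_subset_closedBall hw))).trans ?_
    have : ‖w‖ ≤ 2 * ‖z‖ := by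
      rw [mem_sphere_iff_norm] at hw
      have := norm_add_le (w - z) z
      rw [sub_add_cancel, hw] at this
      nlinarith
    gcongr

theorem borel_ritt_extension (M : ℕ → ℝ) (hM : StronglyRegular M) :
    ∃ γ₀ ∈ Ioc (0:ℝ) 2, ∀ γ : ℝ, 0 < γ → γ < γ₀ →
      ∀ F : ℕ → ℂ, (∃ C > (0:ℝ), ∃ σ > (0:ℝ), ∀ j : ℕ, ‖F j‖ ≤ C * σ ^ j * M j) →
        ∃ f : ℂ → ℂ, AClass M γ ⊤ f ∧
          ∀ j : ℕ, Tendsto (iteratedDeriv j f) (𝓝[Sector γ ⊤] 0)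
            (𝓝 ((Nat.factorial j : ℂ) * F j)) := by
  obtain ⟨hMp, -, -, hlc, -, hsum, A, hA⟩ := hM
  have hmp : ∀ j, 0 < M (j+1) / M j := fun j => div_pos (hMp _) (hMp _)
  have hmono : Monotone (fun j => M (j+1) / M j) := by
    refine monotone_nat_of_le_succ fun j => ?_
    rw [div_le_div_iff₀ (hMp _) (hMp _)]
    have := hlc j
    nlinarith
  obtain ⟨b, hb, K, hK1, hK⟩ := growth_aux (fun j => M (j+1) / M j) hmp hmono
    (fun j : ℕ => M j / (((j:ℝ)+1) * M (j+1)))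
    (fun j => by
      have h1 := (hMp j).ne'
      have h2 := (hMp (j+1)).ne'
      field_simp) hsum A (fun k => by
      have := hA k
      push_cast
      exact this)
  obtain ⟨s, hs, hs1, hcone⟩ := cone_re b
  refine ⟨s / 4, ⟨by positivity, by linarith⟩, ?_⟩
  rintro γ - hγ F ⟨C, hC, σ, hσ, hF⟩
  set f : ℂ → ℂ := fun w => ∑' j, brTerm M F σ b j w with hfdef
  have hrem : ∀ n, ∀ w ∈ coneS s, ‖f w - ∑ k ∈ Finset.range n, F k * w ^ k‖ ≤
      14 * C * (80 * K * σ) ^ n * M n * ‖w‖ ^ n := fun n w hw =>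
    remainder M hMp hmono b hb F C σ hC hσ hF w (hcone w hw).1 (hcone w hw).2 K hK1 hK n
  have hfd : DifferentiableOn ℂ f (coneS s) := by
    refine Complex.differentiableOn_tsum_of_summable_norm
      (u := fun j => 5 * C * M 0 * (1/2 : ℝ) ^ j)
      (summable_geometric_two.mul_left _) ?_ (isOpen_coneS s) ?_
    · intro j w hw
      have hw0 := (hcone w hw).1
      apply DifferentiableAt.differentiableWithinAt
      unfold brTerm cutX
      fun_prop (disch := assumption)
    · intro j w hw
      have := term_high M hMp hmono b hb F C σ hC hσ hF w (hcone w hw).1 (hcone w hw).2 0 j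
      simpa using this
  have hbound : ∀ n, 0 ≤ 14 * C * (80 * K * σ) ^ n * M n := fun n => by
    have := hMp n
    positivity
  have hcls : ∀ (j : ℕ), ∀ z ∈ Sector γ ⊤,
      ‖iteratedDeriv j f z‖ ≤ (14 * C) * (320 * K * σ / s) ^ j * (Nat.factorial j : ℝ) * M j := by
    intro j z hz
    have h := cauchy_rem f _ s γ hs hs1 hγ hfd
      (show Differentiable ℂ (fun w : ℂ => ∑ k ∈ Finset.range j, F k * w ^ k) by fun_prop)
      j j _ (hrem j) (hbound j) z hz
    rw [poly_iter_zero, sub_zero] at h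
    refine h.trans (le_of_eq ?_)
    have hzn : ‖z‖ ≠ 0 := (norm_pos_iff.2 hz.1).ne'
    have e : 320 * K * σ / s = (80 * K * σ) * (2 * ‖z‖) / (s / 2 * ‖z‖) := by
      field_simp; norm_num
    rw [e, div_pow, mul_pow (80 * K * σ)]
    ring
  refine ⟨f, ⟨⟨?_, ?_⟩, 14 * C, by positivity, 320 * K * σ / s, by positivity, hcls⟩, ?_⟩
  · exact hfd.mono fun z hz => sector_ball s γ hs hγ z hz
      (Metric.mem_closedBall_self (by positivity))
  · exact fun j => ⟨_, hcls j⟩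
  · intro j
    rw [tendsto_iff_norm_sub_tendsto_zero]
    set D : ℝ := (Nat.factorial j : ℝ) * (14 * C * (80 * K * σ) ^ (j+1) * M (j+1)) *
      2 ^ (j+1) / (s / 2) ^ j with hD
    have hlim : Tendsto (fun z : ℂ => D * ‖z‖) (𝓝[Sector γ ⊤] 0) (𝓝 0) := by
      have : Tendsto (fun z : ℂ => D * ‖z‖) (𝓝 0) (𝓝 (D * ‖(0:ℂ)‖)) :=
        (Continuous.tendsto (by fun_prop) 0)
      rw [norm_zero, mul_zero] at this
      exact this.mono_left nhdsWithin_le_nhds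
    refine squeeze_zero' (Eventually.of_forall fun z => norm_nonneg _) ?_ hlim
    filter_upwards [self_mem_nhdsWithin] with z hz
    have h := cauchy_rem f _ s γ hs hs1 hγ hfd
      (show Differentiable ℂ (fun w : ℂ => ∑ k ∈ Finset.range (j+1), F k * w ^ k) by fun_prop)
      j (j+1) _ (hrem (j+1)) (hbound (j+1)) z hz
    rw [poly_iter_top] at h
    refine h.trans (le_of_eq ?_)
    have hzn : ‖z‖ ≠ 0 := (norm_pos_iff.2 hz.1).ne'
    rw [hD, mul_pow 2, mul_pow (s/2), pow_succ ‖z‖]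
    field_simp
end
end

section
/- Let 0 < γ < 2, 0 < r < ∞, let M : ℕ → ℝ be a strongly regular sequence, let d ≥ 1, and let a_1, …, a_d ∈ A_M(S_{γ,r}). Let h ∈ A^∞(S_{γ,r}) satisfy h(z)^d + a_1(z)·h(z)^{d-1} + ⋯ + a_d(z) = 0 for all z ∈ S_{γ,r}. Then for all γ' and r' with 0 < γ' < γ and 0 < r' < r, the restriction of h to S_{γ',r'} belongs to A_M(S_{γ',r'}). -/
open Set Filter Topology Complex ENNReal

noncomputable section

/-- Sector described through the real part. -/
def Sec (c R : ℝ) : Set ℂ := {z : ℂ | c * ‖z‖ < z.re ∧ ‖z‖ < R}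

lemma mem_sector_iff {γ : ℝ} (h0 : 0 < γ) (h2 : γ < 2) {r : ℝ≥0∞} (hr : r < ⊤) (z : ℂ) :
    z ∈ Sector γ r ↔ z ∈ Sec (Real.cos (γ * Real.pi / 2)) r.toReal := by
  have hr' : (‖z‖₊ : ℝ≥0∞) < r ↔ ‖z‖ < r.toReal := by
    rw [← ENNReal.toReal_lt_toReal ENNReal.coe_ne_top hr.ne]; simp
  unfold Sector Sec
  simp only [Set.mem_ofPred_eq]
  rw [hr']
  by_cases hz : z = 0
  · simp [hz]
  · have hzp : 0 < ‖z‖ := norm_pos_iff.mpr hz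
    rw [← Complex.norm_mul_cos_arg z, mul_comm (Real.cos _) ‖z‖, mul_lt_mul_iff_right₀ hzp, ← Real.cos_abs (arg z),
      Real.strictAntiOn_cos.lt_iff_gt]
    · simp [hz]
    · exact ⟨by positivity, by nlinarith [Real.pi_pos]⟩
    · exact ⟨abs_nonneg _, Complex.abs_arg_le_pi z⟩

lemma isOpen_Sec (c R : ℝ) : IsOpen (Sec c R) := by
  have h1 : IsOpen {z : ℂ | c * ‖z‖ < z.re} := isOpen_lt (by fun_prop) (by fun_prop)
  have h2 : IsOpen {z : ℂ | ‖z‖ < R} := isOpen_lt (by fun_prop) (by fun_prop)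
  exact h1.inter h2

lemma Sec_ne_zero {c R : ℝ} {z : ℂ} (hz : z ∈ Sec c R) : 0 < ‖z‖ := by
  rcases hz with ⟨h1, _⟩
  by_contra h
  have : z = 0 := by simpa using h
  simp [this] at h1

lemma Sec_smul {c R : ℝ} {z : ℂ} (hz : z ∈ Sec c R) {t : ℝ} (ht : 0 < t) (ht1 : t ≤ 1) :
    (t : ℂ) * z ∈ Sec c R := by
  have hp := Sec_ne_zero hz
  rcases hz with ⟨h1, h2⟩
  constructor
  · simp [abs_of_pos ht]; nlinarith
  · simp [abs_of_pos ht]; nlinarith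

lemma Sec_real {c R : ℝ} (hc1 : c < 1) {p : ℝ} (hp : 0 < p) (hpR : p < R) :
    (p : ℂ) ∈ Sec c R := by
  constructor
  · simp [abs_of_pos hp]; nlinarith
  · simpa [abs_of_pos hp]

lemma Sec_star {c R : ℝ} (hc : |c| ≤ 1) (hc1 : c < 1) {p : ℝ} (hp : 0 < p) (hpR : p < R)
    {z : ℂ} (hz : z ∈ Sec c R) : segment ℝ (p : ℂ) z ⊆ Sec c R := by
  have hzp := Sec_ne_zero hz
  rcases hz with ⟨h1, h2⟩
  rintro w ⟨a, b, ha, hb, hab, rfl⟩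
  have e1 : ‖a • (p : ℂ)‖ = a * p := by simp [abs_of_pos hp, abs_of_nonneg ha]
  have e2 : ‖b • z‖ = b * ‖z‖ := by simp [abs_of_nonneg hb]
  have k1 : ‖a • (p : ℂ) + b • z‖ ≤ a * p + b * ‖z‖ := (norm_add_le _ _).trans (by rw [e1, e2])
  have k2 : |‖a • (p : ℂ) + b • z‖ - b * ‖z‖| ≤ a * p := by
    rw [← e2, ← e1]
    refine (abs_norm_sub_norm_le _ _).trans ?_
    simp
  have k3 : c * (‖a • (p : ℂ) + b • z‖ - b * ‖z‖) ≤ a * p := by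
    refine (le_abs_self _).trans ?_
    rw [abs_mul]
    nlinarith [abs_nonneg (‖a • (p : ℂ) + b • z‖ - b * ‖z‖), abs_nonneg c]
  constructor
  · have : (a • (p : ℂ) + b • z).re = a * p + b * z.re := by simp
    rw [this]
    rcases hb.eq_or_lt with rfl | hb'
    · have : a = 1 := by linarith
      subst this
      simp [abs_of_pos hp]; nlinarith
    · nlinarith
  · rcases hb.eq_or_lt with rfl | hb'
    · have : a = 1 := by linarith
      subst this
      simp [abs_of_pos hp, hpR]
    · nlinarith

lemma Sec_ball {c c' R R' ε : ℝ} (hc : |c| ≤ 1) (h1 : 2 * ε ≤ c' - c) (hε : 0 < ε)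
    (h2 : R' * (1 + ε) ≤ R) {z w : ℂ}
    (hz : z ∈ Sec c' R') (hw : ‖w - z‖ ≤ ε * ‖z‖) : w ∈ Sec c R := by
  have hzp := Sec_ne_zero hz
  rcases hz with ⟨g1, g2⟩
  have hre : |(w - z).re| ≤ ε * ‖z‖ := (Complex.abs_re_le_norm _).trans hw
  have hre' := (abs_le.mp hre).1
  simp only [sub_re] at hre'
  have k2 : |‖w‖ - ‖z‖| ≤ ε * ‖z‖ := (abs_norm_sub_norm_le _ _).trans hw
  have k3 : c * (‖w‖ - ‖z‖) ≤ ε * ‖z‖ := by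
    refine (le_abs_self _).trans ?_
    rw [abs_mul]
    nlinarith [abs_nonneg (‖w‖ - ‖z‖), abs_nonneg c]
  have k4 := (abs_le.mp k2).2
  constructor
  · nlinarith
  · nlinarith

lemma hasDerivAt_iter {U : Set ℂ} (hU : IsOpen U) {f : ℂ → ℂ} (hf : DifferentiableOn ℂ f U)
    (j : ℕ) {z : ℂ} (hz : z ∈ U) :
    HasDerivAt (iteratedDeriv j f) (iteratedDeriv (j+1) f z) z := by
  have h1 : AnalyticAt ℂ f z := hf.analyticAt (hU.mem_nhds hz)
  have h2 : AnalyticAt ℂ (iteratedDeriv j f) z := by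
    rw [iteratedDeriv_eq_iterate]; exact h1.iterated_deriv j
  rw [iteratedDeriv_succ]
  exact h2.differentiableAt.hasDerivAt

lemma exists_limit {c R : ℝ} (hc : |c| ≤ 1) (hc1 : c < 1) (hR : 0 < R) {f f' : ℂ → ℂ}
    (hf : ∀ z ∈ Sec c R, HasDerivAt f (f' z) z) {B : ℝ} (hB : ∀ z ∈ Sec c R, ‖f' z‖ ≤ B) :
    ∃ L, Tendsto f (𝓝[Sec c R] 0) (𝓝 L) := by
  have hB0 : 0 ≤ B := (norm_nonneg _).trans (hB _ (Sec_real hc1 (half_pos hR) (by linarith)))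
  have key : ∀ p : ℝ, 0 < p → p < R → ∀ z ∈ Sec c R, ‖f z - f p‖ ≤ B * ‖z - p‖ := by
    intro p hp hpR z hz
    have hs := Sec_star hc hc1 hp hpR hz
    exact (convex_segment (p:ℂ) z).norm_image_sub_le_of_norm_hasDerivWithin_le
      (fun w hw => (hf w (hs hw)).hasDerivWithinAt) (fun w hw => hB w (hs hw))
      (left_mem_segment ℝ _ _) (right_mem_segment ℝ _ _)
  have hne : (𝓝[Sec c R] (0:ℂ)).NeBot := by
    rw [← mem_closure_iff_nhdsWithin_neBot, Metric.mem_closure_iff]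
    intro ε hε
    have hm : 0 < min ε R / 2 := half_pos (lt_min hε hR)
    have := min_le_left ε R
    have := min_le_right ε R
    refine ⟨((min ε R / 2 : ℝ) : ℂ), Sec_real hc1 hm (by linarith), ?_⟩
    rw [dist_zero_left, Complex.norm_real, Real.norm_eq_abs, abs_of_pos hm]; linarith
  have hca : Cauchy (Filter.map f (𝓝[Sec c R] 0)) := by
    rw [Metric.cauchy_iff]
    refine ⟨inferInstance, fun ε hε => ?_⟩
    set δ := ε / (4 * (B + 1)) with hδ
    have hδ0 : 0 < δ := by positivity
    set p := min δ R / 2 with hpd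
    have hp : 0 < p := half_pos (lt_min hδ0 hR)
    have i1 := min_le_left δ R
    have i2 := min_le_right δ R
    have hU : Sec c R ∩ Metric.ball 0 p ∈ 𝓝[Sec c R] (0:ℂ) :=
      inter_mem self_mem_nhdsWithin (mem_nhdsWithin_of_mem_nhds (Metric.ball_mem_nhds _ hp))
    refine ⟨f '' (Sec c R ∩ Metric.ball 0 p), image_mem_map hU, ?_⟩
    have bd : ∀ z ∈ Sec c R ∩ Metric.ball 0 p, dist (f z) (f p) < ε / 2 := by
      rintro z ⟨hz, hzp⟩
      rw [dist_eq_norm]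
      have hz2 : ‖z‖ < p := by simpa using hzp
      have := key p hp (by linarith) z hz
      have h3 : ‖z - p‖ ≤ 2 * p := by
        refine (norm_sub_le _ _).trans ?_
        rw [Complex.norm_real, Real.norm_eq_abs, abs_of_pos hp]; linarith
      have h4 : B * ‖z - p‖ ≤ B * δ := by
        apply mul_le_mul_of_nonneg_left _ hB0; linarith
      have h5 : (B + 1) * δ = ε / 4 := by rw [hδ]; field_simp
      nlinarith
    rintro _ ⟨z, hz, rfl⟩ _ ⟨w, hw, rfl⟩
    have := dist_triangle_right (f z) (f w) (f p)
    have := bd z hz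
    have := bd w hw
    linarith
  obtain ⟨L, hL⟩ := CompleteSpace.complete hca
  exact ⟨L, hL⟩

lemma tendsto_ray {c R : ℝ} {z : ℂ} (hz : z ∈ Sec c R) :
    Tendsto (fun s : ℝ => (s : ℂ) * z) (𝓝[Ioc 0 1] 0) (𝓝[Sec c R] 0) := by
  apply tendsto_nhdsWithin_iff.mpr
  constructor
  · have : Continuous (fun s : ℝ => (s : ℂ) * z) := by fun_prop
    have h := this.tendsto 0
    simp only [Complex.ofReal_zero, zero_mul] at h
    exact h.mono_left nhdsWithin_le_nhds
  · filter_upwards [self_mem_nhdsWithin] with s hs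
    exact Sec_smul hz hs.1 hs.2

lemma neBot_ray : (𝓝[Ioc (0:ℝ) 1] 0).NeBot := by
  rw [nhdsWithin_Ioc_eq_nhdsGT one_pos]; infer_instance

/-- Integration along a ray. -/
lemma ray_bound {c R : ℝ} {g g' : ℂ → ℂ}
    (hg : ∀ z ∈ Sec c R, HasDerivAt g (g' z) z) (n : ℕ) {K : ℝ}
    (hK : ∀ z ∈ Sec c R, ‖g' z‖ ≤ K * ‖z‖ ^ n)
    (h0 : Tendsto g (𝓝[Sec c R] 0) (𝓝 0)) :
    ∀ z ∈ Sec c R, ‖g z‖ ≤ K / (n + 1) * ‖z‖ ^ (n+1) := by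
  intro z hz
  have hzp := Sec_ne_zero hz
  have step : ∀ s ∈ Ioc (0:ℝ) 1, ‖g z‖ ≤ ‖g (s * z)‖ + K / (n+1) * ‖z‖ ^ (n+1)
      - K / (n+1) * ‖z‖ ^ (n+1) * s ^ (n+1) := by
    intro s hs
    have hd : ∀ t ∈ Icc s 1, HasDerivAt (fun t : ℝ => g (t * z)) (g' (t * z) * z) t := by
      intro t ht
      have h1 := hg _ (Sec_smul hz (hs.1.trans_le ht.1) ht.2)
      have h2 : HasDerivAt (fun t : ℝ => (t : ℂ) * z) z t := by
        simpa using (Complex.ofRealCLM.hasDerivAt (x := t)).mul_const z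
      exact h1.comp t h2
    have := image_norm_le_of_norm_deriv_right_le_deriv_boundary
      (f := fun t : ℝ => g (t * z)) (f' := fun t : ℝ => g' (t * z) * z) (a := s) (b := 1)
      (B := fun t => ‖g (s * z)‖ + K / (n+1) * ‖z‖ ^ (n+1) * t ^ (n+1)
         - K / (n+1) * ‖z‖ ^ (n+1) * s ^ (n+1))
      (B' := fun t => K * ‖z‖ ^ (n+1) * t ^ n)
      (fun t ht => (hd t ht).continuousAt.continuousWithinAt)
      (fun t ht => (hd t ⟨ht.1, ht.2.le⟩).hasDerivWithinAt)
      (by simp)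
      (fun t => by
        have h1 := ((hasDerivAt_pow (n+1) t).const_mul (K / (n+1) * ‖z‖ ^ (n+1))).const_add
          (‖g (s * z)‖) |>.sub_const (K / (n+1) * ‖z‖ ^ (n+1) * s ^ (n+1))
        refine h1.congr_deriv ?_
        push_cast
        have : (n : ℝ) + 1 ≠ 0 := by positivity
        field_simp)
      (fun t ht => by
        have ht0 : 0 < t := hs.1.trans_le ht.1
        have h1 := hK _ (Sec_smul hz ht0 ht.2.le)
        rw [norm_mul]
        rw [norm_mul, Complex.norm_real, Real.norm_eq_abs, abs_of_pos ht0] at h1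
        calc _ ≤ (K * (t * ‖z‖) ^ n) * ‖z‖ := by gcongr
          _ = _ := by ring)
      (right_mem_Icc.mpr hs.2)
    simpa using this
  have lim : Tendsto (fun s : ℝ => ‖g (s * z)‖ + K / (n+1) * ‖z‖ ^ (n+1)
      - K / (n+1) * ‖z‖ ^ (n+1) * s ^ (n+1)) (𝓝[Ioc 0 1] 0)
      (𝓝 (‖(0:ℂ)‖ + K / (n+1) * ‖z‖ ^ (n+1) - K / (n+1) * ‖z‖ ^ (n+1) * 0 ^ (n+1))) := by
    refine Tendsto.sub (Tendsto.add (h0.comp (tendsto_ray hz)).norm tendsto_const_nhds) ?_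
    have : Continuous (fun s : ℝ => K / (n+1) * ‖z‖ ^ (n+1) * s ^ (n+1)) := by fun_prop
    exact (this.tendsto 0).mono_left nhdsWithin_le_nhds
  have := neBot_ray
  have := ge_of_tendsto lim (by filter_upwards [self_mem_nhdsWithin] with s hs using step s hs)
  simpa using this

/-- Taylor expansion at the vertex with a factorial gain. -/
lemma taylor_vertex {c R : ℝ} {F : ℕ → ℂ → ℂ}
    (hF : ∀ j, ∀ z ∈ Sec c R, HasDerivAt (F j) (F (j+1) z) z) {L : ℕ → ℂ}
    (hL : ∀ j, Tendsto (F j) (𝓝[Sec c R] 0) (𝓝 (L j))) (N : ℕ) :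
    ∀ (j : ℕ) (B : ℝ), (∀ z ∈ Sec c R, ‖F (j+N) z‖ ≤ B) → ∀ z ∈ Sec c R,
      ‖F j z - ∑ k ∈ Finset.range N, L (j+k) / (k.factorial : ℂ) * z ^ k‖
        ≤ B / N.factorial * ‖z‖ ^ N := by
  induction N with
  | zero => intro j B hB z hz; simpa using hB z hz
  | succ N ih =>
    intro j B hB
    have hih := ih (j+1) B (by rw [show j+1+N = j+(N+1) by ring]; exact hB)
    have hder : ∀ z ∈ Sec c R,
        HasDerivAt (fun z => F j z - ∑ k ∈ Finset.range (N+1), L (j+k) / (k.factorial : ℂ) * z ^ k)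
        (F (j+1) z - ∑ k ∈ Finset.range N, L (j+1+k) / (k.factorial : ℂ) * z ^ k) z := by
      intro z hz
      refine (hF j z hz).sub ?_
      have h1 : HasDerivAt (fun z : ℂ => ∑ k ∈ Finset.range (N+1),
          L (j+k) / (k.factorial : ℂ) * z ^ k)
          (∑ k ∈ Finset.range (N+1), L (j+k) / (k.factorial : ℂ) * (k * z ^ (k-1))) z := by
        apply HasDerivAt.fun_sum
        intro k _
        exact (hasDerivAt_pow k z).const_mul _
      refine h1.congr_deriv ?_
      rw [Finset.sum_range_succ']
      simp only [Nat.cast_zero, zero_mul, mul_zero, add_zero, add_tsub_cancel_right]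
      apply Finset.sum_congr rfl
      intro k _
      rw [Nat.factorial_succ, show j + (k+1) = j+1+k by ring]
      have : ((k:ℂ) + 1) ≠ 0 := by exact_mod_cast Nat.succ_ne_zero k
      have : (k.factorial : ℂ) ≠ 0 := by exact_mod_cast Nat.factorial_ne_zero k
      push_cast
      field_simp
    have h0 : Tendsto (fun z => F j z - ∑ k ∈ Finset.range (N+1),
        L (j+k) / (k.factorial : ℂ) * z ^ k) (𝓝[Sec c R] 0) (𝓝 0) := by
      have h1 : Continuous (fun z : ℂ => ∑ k ∈ Finset.range (N+1),
        L (j+k) / (k.factorial : ℂ) * z ^ k) := by fun_prop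
      have h2 := (hL j).sub ((h1.tendsto 0).mono_left (nhdsWithin_le_nhds (s := Sec c R)))
      convert h2 using 2
      rw [Finset.sum_range_succ']
      simp
    intro z hz
    have := ray_bound hder N hih h0 z hz
    refine this.trans (le_of_eq ?_)
    rw [Nat.factorial_succ]
    push_cast
    field_simp

/-- Log-convex normalized weights. -/
structure Wt (W : ℕ → ℝ) : Prop where
  pos : ∀ i, 0 < W i
  zero : W 0 = 1
  lc : ∀ i, W (i+1) ^ 2 ≤ W i * W (i+2)

lemma Wt.ratio {W : ℕ → ℝ} (hW : Wt W) (i k : ℕ) : W (i+1) * W (i+k) ≤ W i * W (i+k+1) := by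
  induction k with
  | zero => simp [mul_comm]
  | succ k ih =>
    have h1 := hW.lc (i+k)
    have p0 := hW.pos i
    have p1 := hW.pos (i+k)
    have p2 := hW.pos (i+k+1)
    have p3 := hW.pos (i+k+2)
    have p4 := hW.pos (i+1)
    have e : i + (k+1) = i+k+1 := by ring
    rw [e, show i+k+1+1 = i+k+2 by ring]
    by_contra hcon
    push Not at hcon
    have : W (i+1) * W (i+k) * (W i * W (i+k+2)) < W i * W (i+k+1) * (W (i+1) * W (i+k+1)) :=
      mul_lt_mul' ih hcon (by positivity) (by positivity)
    have h2 : W i * W (i+1) * (W (i+k+1)^2) ≤ W i * W (i+1) * (W (i+k) * W (i+k+2)) := by gcongr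
    nlinarith

lemma Wt.mul_le {W : ℕ → ℝ} (hW : Wt W) (i j : ℕ) : W i * W j ≤ W (i+j) := by
  induction i with
  | zero => simp [hW.zero]
  | succ i ih =>
    have h1 := hW.ratio i j
    have h0 := hW.ratio 0 i
    have p0 := hW.pos i
    have p1 := hW.pos (i+j)
    have p2 := hW.pos (i+1)
    rw [show i+1+j = i+j+1 by ring]
    have : W (i+1) * (W i * W j) ≤ W i * W (i+j+1) :=
      (mul_le_mul_of_nonneg_left ih p2.le).trans h1
    have h3 : W i * (W (i+1) * W j) ≤ W i * W (i+j+1) := by linarith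
    exact le_of_mul_le_mul_left h3 p0

lemma Wt.down {W : ℕ → ℝ} (_hW : Wt W) {t : ℝ} (ht : 0 ≤ t) {N : ℕ}
    (hN : ∀ i < N, t * W (i+1) ≤ W i) (n k : ℕ) (h : n + k ≤ N) : t ^ k * W (n+k) ≤ W n := by
  induction k with
  | zero => simp
  | succ k ih =>
    have h1 := hN (n+k) (by omega)
    calc t ^ (k+1) * W (n+(k+1)) = t ^ k * (t * W (n+k+1)) := by
          rw [pow_succ, show n+(k+1) = n+k+1 by ring]; ring
      _ ≤ t ^ k * W (n+k) := by gcongr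
      _ ≤ _ := ih (by omega)

lemma Wt.cross {W : ℕ → ℝ} (hW : Wt W) {t : ℝ} (ht : 0 ≤ t) {N : ℕ}
    (hN : ∀ i < N, t * W (i+1) ≤ W i) (i j : ℕ) (hi : i ≤ N) (hj : j ≤ N) (h : N ≤ i + j) :
    t ^ (i+j-N) * (W i * W j) ≤ W N := by
  have h1 := hW.down ht hN (N-i) (i+j-N) (by omega)
  rw [show N - i + (i+j-N) = j by omega] at h1
  have h2 := hW.mul_le i (N-i)
  rw [show i + (N-i) = N by omega] at h2
  have := hW.pos i
  nlinarith

open PowerSeries in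
/-- Truncated weighted norm. -/
def nrm (W : ℕ → ℝ) (N : ℕ) (x : PowerSeries ℂ) : ℝ :=
  ∑ k ∈ Finset.range N, ‖coeff k x‖ / W k

open PowerSeries in
/-- Value of the truncated series. -/
def tv (N : ℕ) (x : PowerSeries ℂ) (z : ℂ) : ℂ := ∑ k ∈ Finset.range N, coeff k x * z ^ k

lemma pair_sum {A : Type*} [AddCommMonoid A] (N : ℕ) (F : ℕ × ℕ → A) :
    ∑ n ∈ Finset.range N, ∑ p ∈ Finset.HasAntidiagonal.antidiagonal n, F p =
      ∑ p ∈ (Finset.range N ×ˢ Finset.range N) with p.1 + p.2 < N, F p := by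
  rw [← Finset.sum_fiberwise_of_maps_to (g := fun p : ℕ × ℕ => p.1 + p.2) (t := Finset.range N)]
  · apply Finset.sum_congr rfl
    intro n hn
    apply Finset.sum_congr _ (fun _ _ => rfl)
    ext p
    simp only [Finset.HasAntidiagonal.mem_antidiagonal, Finset.mem_filter, Finset.mem_product, Finset.mem_range]
      at hn ⊢
    omega
  · intro p hp
    simp only [Finset.mem_filter, Finset.mem_range] at hp ⊢
    exact hp.2

section
variable {W : ℕ → ℝ}

lemma nrm_nonneg (hW : Wt W) (N : ℕ) (x : PowerSeries ℂ) : 0 ≤ nrm W N x :=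
  Finset.sum_nonneg fun k _ => div_nonneg (norm_nonneg _) (hW.pos k).le

lemma nrm_mono (hW : Wt W) {N N' : ℕ} (h : N ≤ N') (x : PowerSeries ℂ) :
    nrm W N x ≤ nrm W N' x :=
  Finset.sum_le_sum_of_subset_of_nonneg (Finset.range_mono h)
    fun k _ _ => div_nonneg (norm_nonneg _) (hW.pos k).le

lemma nrm_add (hW : Wt W) (N : ℕ) (x y : PowerSeries ℂ) :
    nrm W N (x + y) ≤ nrm W N x + nrm W N y := by
  unfold nrm
  rw [← Finset.sum_add_distrib]
  apply Finset.sum_le_sum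
  intro k _
  rw [← add_div]
  have := hW.pos k
  gcongr
  rw [map_add]; exact norm_add_le _ _

lemma nrm_conv (hW : Wt W) (N : ℕ) (x y : PowerSeries ℂ) :
    nrm W N (x * y) ≤ ∑ p ∈ (Finset.range N ×ˢ Finset.range N) with p.1 + p.2 < N,
      ‖PowerSeries.coeff p.1 x‖ / W p.1 * (‖PowerSeries.coeff p.2 y‖ / W p.2) := by
  rw [← pair_sum]
  unfold nrm
  apply Finset.sum_le_sum
  intro n _
  rw [PowerSeries.coeff_mul]
  calc _ ≤ (∑ p ∈ Finset.HasAntidiagonal.antidiagonal n, ‖PowerSeries.coeff p.1 x * PowerSeries.coeff p.2 y‖) / W n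
        := by have := hW.pos n; gcongr; exact norm_sum_le _ _
    _ = ∑ p ∈ Finset.HasAntidiagonal.antidiagonal n, ‖PowerSeries.coeff p.1 x * PowerSeries.coeff p.2 y‖ / W n :=
        Finset.sum_div _ _ _
    _ ≤ _ := by
        apply Finset.sum_le_sum
        intro p hp
        rw [Finset.HasAntidiagonal.mem_antidiagonal] at hp
        rw [div_mul_div_comm, norm_mul, ← hp]
        have := hW.pos p.1
        have := hW.pos p.2
        exact div_le_div_of_nonneg_left (by positivity) (by positivity) (hW.mul_le _ _)

lemma nrm_prod (N : ℕ) (x y : PowerSeries ℂ) :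
    nrm W N x * nrm W N y = ∑ p ∈ Finset.range N ×ˢ Finset.range N,
      ‖PowerSeries.coeff p.1 x‖ / W p.1 * (‖PowerSeries.coeff p.2 y‖ / W p.2) := by
  unfold nrm
  rw [Finset.sum_mul_sum, Finset.sum_product]

lemma nrm_mul (hW : Wt W) (N : ℕ) (x y : PowerSeries ℂ) :
    nrm W N (x * y) ≤ nrm W N x * nrm W N y := by
  refine (nrm_conv hW N x y).trans ?_
  rw [nrm_prod]
  apply Finset.sum_le_sum_of_subset_of_nonneg (Finset.filter_subset _ _)
  intro p _ _
  have := hW.pos p.1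
  have := hW.pos p.2
  positivity

lemma tv_mul_sub (N : ℕ) (x y : PowerSeries ℂ) (z : ℂ) :
    tv N x z * tv N y z - tv N (x * y) z =
    ∑ p ∈ (Finset.range N ×ˢ Finset.range N) with ¬ (p.1 + p.2 < N),
      PowerSeries.coeff p.1 x * PowerSeries.coeff p.2 y * z ^ (p.1 + p.2) := by
  have h1 : tv N x z * tv N y z = ∑ p ∈ Finset.range N ×ˢ Finset.range N,
      PowerSeries.coeff p.1 x * PowerSeries.coeff p.2 y * z ^ (p.1 + p.2) := by
    unfold tv
    rw [Finset.sum_mul_sum, Finset.sum_product]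
    refine Finset.sum_congr rfl fun i _ => Finset.sum_congr rfl fun j _ => ?_
    ring
  have h2 : tv N (x * y) z = ∑ p ∈ (Finset.range N ×ˢ Finset.range N) with p.1 + p.2 < N,
      PowerSeries.coeff p.1 x * PowerSeries.coeff p.2 y * z ^ (p.1 + p.2) := by
    rw [← pair_sum]
    unfold tv
    apply Finset.sum_congr rfl
    intro n _
    rw [PowerSeries.coeff_mul, Finset.sum_mul]
    apply Finset.sum_congr rfl
    intro p hp
    rw [Finset.HasAntidiagonal.mem_antidiagonal] at hp
    rw [hp]
  rw [h1, h2, sub_eq_iff_eq_add, add_comm]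
  exact (Finset.sum_filter_add_sum_filter_not _ (fun p : ℕ × ℕ => p.1 + p.2 < N) _).symm

lemma nrm_mul_tail (hW : Wt W) (N : ℕ) (x y : PowerSeries ℂ) {z : ℂ} (hz : 0 < ‖z‖)
    (hN : ∀ i < N, ‖z‖ * W (i+1) ≤ W i) :
    nrm W N (x * y) + ‖tv N x z * tv N y z - tv N (x * y) z‖ / (W N * ‖z‖ ^ N)
      ≤ nrm W N x * nrm W N y := by
  rw [nrm_prod, ← Finset.sum_filter_add_sum_filter_not _ (fun p : ℕ × ℕ => p.1 + p.2 < N)]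
  apply add_le_add (nrm_conv hW N x y)
  have hWN := hW.pos N
  rw [tv_mul_sub]
  rw [div_le_iff₀ (by positivity), Finset.sum_mul]
  refine (norm_sum_le _ _).trans ?_
  apply Finset.sum_le_sum
  rintro ⟨i, j⟩ hp
  simp only [Finset.mem_filter, Finset.mem_product, Finset.mem_range] at hp
  have hc := hW.cross hz.le hN i j (by omega) (by omega) (by omega)
  have hi := hW.pos i
  have hj := hW.pos j
  rw [norm_mul, norm_mul, norm_pow]
  have e : ‖z‖ ^ (i + j) = ‖z‖ ^ (i+j-N) * ‖z‖ ^ N := by rw [← pow_add]; congr 1; omega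
  rw [e]
  set a := ‖PowerSeries.coeff i x‖
  set b := ‖PowerSeries.coeff j y‖
  have ha : 0 ≤ a := norm_nonneg _
  have hb : 0 ≤ b := norm_nonneg _
  have h3 : ‖z‖ ^ (i+j-N) ≤ W N / (W i * W j) := by rw [le_div_iff₀ (by positivity)]; exact hc
  calc a * b * (‖z‖ ^ (i+j-N) * ‖z‖ ^ N) ≤ a * b * (W N / (W i * W j) * ‖z‖ ^ N) := by gcongr
    _ = _ := by field_simp

/-- Norm on pairs (value at `z`, formal expansion). -/
def nu (W : ℕ → ℝ) (N : ℕ) (z : ℂ) (p : ℂ × PowerSeries ℂ) : ℝ :=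
  nrm W N p.2 + ‖p.1 - tv N p.2 z‖ / (W N * ‖z‖ ^ N)

lemma tv_add (N : ℕ) (x y : PowerSeries ℂ) (z : ℂ) : tv N (x + y) z = tv N x z + tv N y z := by
  simp [tv, add_mul, Finset.sum_add_distrib]

lemma nu_nonneg (hW : Wt W) (N : ℕ) (z : ℂ) (p : ℂ × PowerSeries ℂ) : 0 ≤ nu W N z p := by
  have := hW.pos N
  have := nrm_nonneg hW N p.2
  unfold nu; positivity

lemma nu_add (hW : Wt W) (N : ℕ) (z : ℂ) (p q : ℂ × PowerSeries ℂ) :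
    nu W N z (p + q) ≤ nu W N z p + nu W N z q := by
  unfold nu
  have h1 := nrm_add hW N p.2 q.2
  have h2 : ‖(p+q).1 - tv N (p+q).2 z‖ / (W N * ‖z‖ ^ N) ≤
      ‖p.1 - tv N p.2 z‖ / (W N * ‖z‖ ^ N) + ‖q.1 - tv N q.2 z‖ / (W N * ‖z‖ ^ N) := by
    rw [← add_div]
    have := hW.pos N
    gcongr
    rw [Prod.fst_add, Prod.snd_add, tv_add, add_sub_add_comm]
    exact norm_add_le _ _
  rw [Prod.snd_add] at *
  linarith

lemma nu_zero (N : ℕ) (z : ℂ) : nu W N z 0 = 0 := by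
  simp [nu, nrm, tv]

lemma coeff_le_nrm (hW : Wt W) {N k : ℕ} (hk : k < N) (x : PowerSeries ℂ) :
    ‖PowerSeries.coeff k x‖ ≤ nrm W N x * W k := by
  rw [← div_le_iff₀ (hW.pos k)]
  exact Finset.single_le_sum (f := fun k => ‖PowerSeries.coeff k x‖ / W k)
    (fun k _ => div_nonneg (norm_nonneg _) (hW.pos k).le) (Finset.mem_range.mpr hk)

lemma tail_le (hW : Wt W) {N n : ℕ} (hn : n ≤ N) (p : ℂ × PowerSeries ℂ) {z : ℂ} (hz : 0 < ‖z‖)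
    (hN : ∀ i < N, ‖z‖ * W (i+1) ≤ W i) :
    ‖p.1 - tv n p.2 z‖ ≤ nu W N z p * (W n * ‖z‖ ^ n) := by
  have hWN := hW.pos N
  have hWn := hW.pos n
  have key : ∀ k, n ≤ k → k ≤ N → W k * ‖z‖ ^ k ≤ W n * ‖z‖ ^ n := by
    intro k h1 h2
    have := hW.down hz.le hN n (k-n) (by omega)
    rw [show n + (k-n) = k by omega] at this
    calc W k * ‖z‖ ^ k = (‖z‖ ^ (k-n) * W k) * ‖z‖ ^ n := by
          conv_lhs => rw [show k = (k - n) + n by omega, pow_add]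
          rw [show k - n + n = k by omega]; ring
      _ ≤ _ := by gcongr
  have e : p.1 - tv n p.2 z = (p.1 - tv N p.2 z) +
      ∑ k ∈ Finset.Ico n N, PowerSeries.coeff k p.2 * z ^ k := by
    unfold tv
    rw [← Finset.sum_range_add_sum_Ico _ hn]; ring
  rw [e]
  refine (norm_add_le _ _).trans ?_
  unfold nu
  rw [add_mul, add_comm (nrm W N p.2 * _)]
  apply add_le_add
  · rw [div_mul_eq_mul_div, le_div_iff₀ (by positivity)]
    have := key N hn le_rfl
    gcongr
  · refine (norm_sum_le _ _).trans ?_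
    calc ∑ k ∈ Finset.Ico n N, ‖PowerSeries.coeff k p.2 * z ^ k‖
        ≤ ∑ k ∈ Finset.Ico n N, ‖PowerSeries.coeff k p.2‖ / W k * (W n * ‖z‖ ^ n) := by
          apply Finset.sum_le_sum
          intro k hk
          rw [Finset.mem_Ico] at hk
          have h1 := key k hk.1 hk.2.le
          have h2 := hW.pos k
          rw [norm_mul, norm_pow]
          calc _ = ‖PowerSeries.coeff k p.2‖ / W k * (W k * ‖z‖ ^ k) := by field_simp
            _ ≤ _ := by gcongr
      _ = (∑ k ∈ Finset.Ico n N, ‖PowerSeries.coeff k p.2‖ / W k) * (W n * ‖z‖ ^ n) :=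
          (Finset.sum_mul _ _ _).symm
      _ ≤ _ := by
          gcongr
          apply Finset.sum_le_sum_of_subset_of_nonneg
          · intro k hk; rw [Finset.mem_Ico] at hk; exact Finset.mem_range.mpr hk.2
          · intro k _ _; exact div_nonneg (norm_nonneg _) (hW.pos k).le

lemma nu_mul (hW : Wt W) (N : ℕ) (p q : ℂ × PowerSeries ℂ) {z : ℂ} (hz : 0 < ‖z‖)
    (hN : ∀ i < N, ‖z‖ * W (i+1) ≤ W i) :
    nu W N z (p * q) ≤ nu W N z p * nu W N z q := by
  have hWN := hW.pos N
  have hω : W N * ‖z‖ ^ N ≤ 1 := by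
    have := hW.down hz.le hN 0 N (by omega)
    rw [zero_add, hW.zero] at this
    linarith
  have hω0 : 0 < W N * ‖z‖ ^ N := by positivity
  have hmain := nrm_mul_tail hW N p.2 q.2 hz hN
  have htp : ‖tv N p.2 z‖ ≤ nrm W N p.2 := by
    have := tail_le hW (Nat.zero_le N) (tv N p.2 z, p.2) hz hN
    simpa [tv, nu, hW.zero] using this
  have htq : ‖tv N q.2 z‖ ≤ nrm W N q.2 := by
    have := tail_le hW (Nat.zero_le N) (tv N q.2 z, q.2) hz hN
    simpa [tv, nu, hW.zero] using this
  unfold nu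
  rw [Prod.fst_mul, Prod.snd_mul]
  set ω := W N * ‖z‖ ^ N
  set P := tv N p.2 z
  set Q := tv N q.2 z
  set e := ‖p.1 - P‖ with he
  set f := ‖q.1 - Q‖ with hf
  have e0 : 0 ≤ e := norm_nonneg _
  have f0 : 0 ≤ f := norm_nonneg _
  have hb : ‖p.1 * q.1 - tv N (p.2 * q.2) z‖ ≤
      e * f + nrm W N p.2 * f + e * nrm W N q.2 + ‖P * Q - tv N (p.2 * q.2) z‖ := by
    have : p.1 * q.1 - tv N (p.2 * q.2) z = (p.1 - P) * (q.1 - Q) + P * (q.1 - Q) + (p.1 - P) * Q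
      + (P * Q - tv N (p.2 * q.2) z) := by ring
    rw [this]
    refine (norm_add_le _ _).trans ?_
    gcongr
    refine (norm_add_le _ _).trans ?_
    rw [norm_mul (p.1 - P) Q]
    refine add_le_add ((norm_add_le _ _).trans ?_) (by gcongr)
    rw [norm_mul, norm_mul]
    gcongr
  have h2 : ‖p.1 * q.1 - tv N (p.2 * q.2) z‖ / ω ≤ (e * f + nrm W N p.2 * f + e * nrm W N q.2) / ω
      + ‖P * Q - tv N (p.2 * q.2) z‖ / ω := by
    rw [← add_div]; gcongr
  have h3 : e * f / ω ≤ (e / ω) * (f / ω) := by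
    rw [div_mul_div_comm]
    exact div_le_div_of_nonneg_left (by positivity) (by positivity) (by nlinarith)
  have h4 : (e * f + nrm W N p.2 * f + e * nrm W N q.2) / ω =
    e * f / ω + nrm W N p.2 * (f / ω) + (e / ω) * nrm W N q.2 := by ring
  nlinarith

lemma nu_one (hW : Wt W) {N : ℕ} (hN : 1 ≤ N) (z : ℂ) : nu W N z 1 = 1 := by
  obtain ⟨n, rfl⟩ : ∃ n, N = n + 1 := ⟨N-1, by omega⟩
  have h1 : nrm W (n+1) (1 : PowerSeries ℂ) = 1 := by
    unfold nrm
    rw [Finset.sum_range_succ']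
    simp [PowerSeries.coeff_one, hW.zero]
  have h2 : tv (n+1) (1 : PowerSeries ℂ) z = 1 := by
    unfold tv
    rw [Finset.sum_range_succ']
    simp [PowerSeries.coeff_one]
  simp [nu, h1, h2]

lemma nrm_one_le (hW : Wt W) (N : ℕ) : nrm W N (1 : PowerSeries ℂ) ≤ 1 := by
  refine (nrm_mono hW (Nat.le_succ N) _).trans ?_
  unfold nrm
  rw [Finset.sum_range_succ']
  simp [PowerSeries.coeff_one, hW.zero]

end

/-- The properties of the weight sequence that are used. -/
structure SR (M : ℕ → ℝ) (A : ℝ) : Prop where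
  wt : Wt M
  mono : Monotone M
  one_le : 1 ≤ A
  mg : ∀ j k, M (j+k) ≤ A ^ (j+k) * (M j * M k)

lemma SR.one_le_M {M : ℕ → ℝ} {A : ℝ} (h : SR M A) (k : ℕ) : 1 ≤ M k := by
  rw [← h.wt.zero]; exact h.mono (Nat.zero_le k)

lemma StronglyRegular.sr {M : ℕ → ℝ} (hM : StronglyRegular M) : ∃ A, SR M A := by
  obtain ⟨hpos, h0, hmono, hlc, ⟨A, hA⟩, _⟩ := hM
  refine ⟨max A 1, ⟨hpos, h0, hlc⟩, hmono, le_max_right _ _, fun j k => ?_⟩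
  have hj := hpos j
  have hk := hpos k
  have hjk := hpos (j+k)
  rcases Nat.eq_zero_or_pos (j+k) with h | h
  · obtain ⟨rfl, rfl⟩ : j = 0 ∧ k = 0 := by omega
    simp [h0]
  · have h1 := hA j k h
    have h2 : (M (j+k) / (M j * M k)) = ((M (j+k) / (M j * M k)) ^ ((1:ℝ)/((j:ℝ)+(k:ℝ)))) ^ (j+k) := by
      rw [← Real.rpow_natCast, ← Real.rpow_mul (by positivity)]
      have : ((j:ℝ)+(k:ℝ)) ≠ 0 := by exact_mod_cast h.ne'
      push_cast
      rw [one_div, inv_mul_cancel₀ this, Real.rpow_one]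
    rw [← div_le_iff₀ (by positivity), h2]
    gcongr
    exact h1.trans (le_max_left _ _)

/-- Rescaled weights. -/
def wt (M : ℕ → ℝ) (ρ : ℝ) (i : ℕ) : ℝ := M i * ρ ^ i

lemma wt_wt {M : ℕ → ℝ} (hM : Wt M) {ρ : ℝ} (hρ : 0 < ρ) : Wt (wt M ρ) where
  pos i := by have := hM.pos i; unfold wt; positivity
  zero := by simp [wt, hM.zero]
  lc i := by
    unfold wt
    have := hM.lc i
    calc _ = M (i+1) ^ 2 * (ρ ^ (i+1)) ^ 2 := by ring
      _ ≤ (M i * M (i+2)) * (ρ ^ (i+1)) ^ 2 := by gcongr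
      _ = _ := by ring

lemma nrm_anti {M : ℕ → ℝ} (hM : Wt M) {ρ ρ' : ℝ} (hρ : 0 < ρ) (h : ρ ≤ ρ') (N : ℕ)
    (x : PowerSeries ℂ) : nrm (wt M ρ') N x ≤ nrm (wt M ρ) N x := by
  unfold nrm
  apply Finset.sum_le_sum
  intro k _
  have := hM.pos k
  unfold wt
  gcongr

/-- Formal power series of class `M`. -/
def InLam (M : ℕ → ℝ) (x : PowerSeries ℂ) : Prop :=
  ∃ ρ : ℝ, 1 ≤ ρ ∧ ∃ K : ℝ, ∀ N, nrm (wt M ρ) N x ≤ K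

lemma InLam.coeff {M : ℕ → ℝ} (hM : Wt M) {x : PowerSeries ℂ} (h : InLam M x) :
    ∃ C σ : ℝ, 0 ≤ C ∧ 1 ≤ σ ∧ ∀ k, ‖PowerSeries.coeff k x‖ ≤ C * σ ^ k * M k := by
  obtain ⟨ρ, hρ, K, hK⟩ := h
  have hρ0 : 0 < ρ := by linarith
  refine ⟨K, ρ, (nrm_nonneg (wt_wt hM hρ0) 0 x).trans (hK 0), hρ, fun k => ?_⟩
  have h1 := coeff_le_nrm (wt_wt hM hρ0) (Nat.lt_succ_self k) x
  have := hM.pos k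
  refine h1.trans ?_
  unfold wt
  calc _ ≤ K * (M k * ρ ^ k) := by gcongr; exact hK _
    _ = _ := by ring

lemma nrm_of_coeff {M : ℕ → ℝ} (hM : Wt M) {x : PowerSeries ℂ} {C σ : ℝ} (hσ : 0 < σ) {ρ : ℝ}
    (hρ : 2 * σ ≤ ρ)
    (h : ∀ k, ‖PowerSeries.coeff k x‖ ≤ C * σ ^ k * M k) (N : ℕ) :
    nrm (wt M ρ) N x ≤ C * 2 := by
  have hC : 0 ≤ C := by
    have := (norm_nonneg _).trans (h 0)
    simpa [hM.zero] using this
  refine (nrm_anti hM (by positivity) hρ N x).trans ?_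
  unfold nrm
  calc _ ≤ ∑ k ∈ Finset.range N, C * (1/2:ℝ) ^ k := by
        apply Finset.sum_le_sum
        intro k _
        have := hM.pos k
        unfold wt
        rw [div_le_iff₀ (by positivity)]
        refine (h k).trans (le_of_eq ?_)
        rw [mul_pow, div_pow]
        field_simp
        simp
    _ = C * ∑ k ∈ Finset.range N, (1/2:ℝ) ^ k := (Finset.mul_sum _ _ _).symm
    _ ≤ _ := by
        gcongr
        exact sum_geometric_two_le N

lemma InLam.of_coeff {M : ℕ → ℝ} (hM : Wt M) {x : PowerSeries ℂ} {C σ : ℝ} (hσ : 1 ≤ σ)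
    (h : ∀ k, ‖PowerSeries.coeff k x‖ ≤ C * σ ^ k * M k) : InLam M x :=
  ⟨2 * σ, by linarith, C * 2, fun N => nrm_of_coeff hM (by linarith) le_rfl h N⟩

/-- The ring of formal power series of class `M`. -/
def Lam (M : ℕ → ℝ) (hM : Wt M) : Subring (PowerSeries ℂ) where
  carrier := {x | InLam M x}
  mul_mem' := by
    rintro x y ⟨ρ, hρ, K, hK⟩ ⟨ρ', hρ', K', hK'⟩
    refine ⟨max ρ ρ', le_max_of_le_left hρ, K * K', fun N => ?_⟩
    have h0 : 0 < max ρ ρ' := by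
      have := le_max_left ρ ρ'
      linarith
    refine (nrm_mul (wt_wt hM h0) N x y).trans ?_
    have h1 := (nrm_anti hM (by linarith) (le_max_left ρ ρ') N x).trans (hK N)
    have h2 := (nrm_anti hM (by linarith) (le_max_right ρ ρ') N y).trans (hK' N)
    exact mul_le_mul h1 h2 (nrm_nonneg (wt_wt hM h0) _ _)
      ((nrm_nonneg (wt_wt hM h0) _ _).trans h1)
  one_mem' := ⟨1, le_rfl, 1, fun N => nrm_one_le (wt_wt hM one_pos) N⟩
  add_mem' := by
    rintro x y ⟨ρ, hρ, K, hK⟩ ⟨ρ', hρ', K', hK'⟩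
    refine ⟨max ρ ρ', le_max_of_le_left hρ, K + K', fun N => ?_⟩
    have h0 : 0 < max ρ ρ' := by
      have := le_max_left ρ ρ'
      linarith
    refine (nrm_add (wt_wt hM h0) N x y).trans ?_
    have h1 := (nrm_anti hM (by linarith) (le_max_left ρ ρ') N x).trans (hK N)
    have h2 := (nrm_anti hM (by linarith) (le_max_right ρ ρ') N y).trans (hK' N)
    exact add_le_add h1 h2
  zero_mem' := ⟨1, le_rfl, 0, fun N => by simp [nrm]⟩
  neg_mem' := by
    rintro x ⟨ρ, hρ, K, hK⟩
    refine ⟨ρ, hρ, K, fun N => ?_⟩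
    simpa [nrm] using hK N

lemma mem_Lam {M : ℕ → ℝ} (hM : Wt M) {x : PowerSeries ℂ} : x ∈ Lam M hM ↔ InLam M x := Iff.rfl

lemma InLam.of_finite {M : ℕ → ℝ} {A : ℝ} (hM : SR M A) {x : PowerSeries ℂ} {L : ℕ}
    (h : ∀ k, L ≤ k → PowerSeries.coeff k x = 0) : InLam M x := by
  apply InLam.of_coeff hM.wt (C := ∑ k ∈ Finset.range L, ‖PowerSeries.coeff k x‖) (le_refl 1)
  intro k
  have h1 := hM.one_le_M k
  have h2 : 0 ≤ ∑ k ∈ Finset.range L, ‖PowerSeries.coeff k x‖ :=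
    Finset.sum_nonneg fun _ _ => norm_nonneg _
  rw [one_pow, mul_one]
  by_cases hk : L ≤ k
  · rw [h k hk]; simp; positivity
  · have := Finset.single_le_sum (f := fun k => ‖PowerSeries.coeff k x‖)
      (fun k _ => norm_nonneg _) (Finset.mem_range.mpr (not_le.mp hk))
    nlinarith

lemma InLam.shift {M : ℕ → ℝ} {A : ℝ} (hM : SR M A) {y : PowerSeries ℂ} (n : ℕ)
    (h : InLam M (PowerSeries.X ^ n * y)) : InLam M y := by
  obtain ⟨C, σ, hC, hσ, hb⟩ := h.coeff hM.wt
  have hA := hM.one_le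
  apply InLam.of_coeff hM.wt (C := C * σ ^ n * A ^ n * M n) (σ := σ * A) (by nlinarith)
  intro k
  have h1 := hb (k+n)
  rw [PowerSeries.coeff_X_pow_mul] at h1
  have h2 := hM.mg k n
  calc _ ≤ C * σ ^ (k+n) * M (k+n) := h1
    _ ≤ C * σ ^ (k+n) * (A ^ (k+n) * (M k * M n)) := by gcongr
    _ = _ := by ring

lemma Lam_common {M : ℕ → ℝ} (hM : Wt M) {ι : Type*} (s : Finset ι) (x : ι → PowerSeries ℂ)
    (h : ∀ i, InLam M (x i)) :
    ∃ ρ : ℝ, 1 ≤ ρ ∧ ∃ K : ℝ, 1 ≤ K ∧ ∀ ρ', ρ ≤ ρ' → ∀ N, ∀ i ∈ s, nrm (wt M ρ') N (x i) ≤ K := by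
  choose ρ hρ K hK using h
  have hK0 : ∀ i, 0 ≤ K i := fun i =>
    (nrm_nonneg (wt_wt hM (by linarith [hρ i] : 0 < ρ i)) 0 (x i)).trans (hK i 0)
  refine ⟨1 + ∑ i ∈ s, ρ i, ?_, 1 + ∑ i ∈ s, K i, ?_, fun ρ' hρ' N i hi => ?_⟩
  · have := Finset.sum_nonneg (s := s) (fun i _ => (zero_le_one.trans (hρ i)))
    linarith
  · have := Finset.sum_nonneg (s := s) (fun i _ => hK0 i)
    linarith
  · have h1 := Finset.single_le_sum (f := ρ) (fun i _ => (zero_le_one.trans (hρ i))) hi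
    have h2 := Finset.single_le_sum (f := K) (fun i _ => hK0 i) hi
    have h3 := nrm_anti hM (by linarith [hρ i] : 0 < ρ i) (by linarith : ρ i ≤ ρ') N (x i)
    linarith [hK i N]

lemma nrm_X_mul {M : ℕ → ℝ} {A : ℝ} (hM : SR M A) {ρ : ℝ} (hρ : 0 < ρ) (N : ℕ)
    (y : PowerSeries ℂ) : nrm (wt M ρ) (N+1) (PowerSeries.X * y) ≤ ρ⁻¹ * nrm (wt M ρ) N y := by
  unfold nrm
  rw [Finset.sum_range_succ', Finset.mul_sum]
  simp only [PowerSeries.coeff_succ_X_mul, PowerSeries.coeff_zero_X_mul, norm_zero, zero_div,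
    add_zero]
  apply Finset.sum_le_sum
  intro k _
  have h1 := hM.wt.pos k
  have h2 := hM.wt.pos (k+1)
  have h3 : M k ≤ M (k+1) := hM.mono (Nat.le_succ k)
  unfold wt
  rw [inv_mul_eq_div, div_div]
  apply div_le_div_of_nonneg_left (norm_nonneg _) (by positivity)
  calc M k * ρ ^ k * ρ ≤ M (k+1) * ρ ^ k * ρ := by gcongr
    _ = _ := by ring

lemma nrm_pow {W : ℕ → ℝ} (hW : Wt W) (N i : ℕ) (x : PowerSeries ℂ) :
    nrm W N (x ^ i) ≤ nrm W N x ^ i := by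
  induction i with
  | zero => simpa using nrm_one_le hW N
  | succ i ih =>
    rw [pow_succ, pow_succ]
    refine (nrm_mul hW N _ _).trans ?_
    have := nrm_nonneg hW N x
    gcongr

lemma nrm_sum {W : ℕ → ℝ} (hW : Wt W) (N : ℕ) {ι : Type*} (s : Finset ι)
    (x : ι → PowerSeries ℂ) : nrm W N (∑ i ∈ s, x i) ≤ ∑ i ∈ s, nrm W N (x i) := by
  classical
  induction s using Finset.induction_on with
  | empty => simp [nrm]
  | insert a s ha ih =>
    rw [Finset.sum_insert ha, Finset.sum_insert ha]
    exact (nrm_add hW N _ _).trans (by gcongr)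

lemma formal_solve {M : ℕ → ℝ} {A : ℝ} (hM : SR M A) (E : Lam M hM.wt)
    (G : Polynomial (Lam M hM.wt)) (v : PowerSeries ℂ)
    (hv : v = (E : PowerSeries ℂ) + PowerSeries.X * Polynomial.aeval v G) : InLam M v := by
  obtain ⟨ρ0, hρ0, K, hK1, hK⟩ := Lam_common hM.wt (Finset.range (G.natDegree + 2))
    (fun i => if i = 0 then (E : PowerSeries ℂ) else (G.coeff (i-1) : PowerSeries ℂ))
    (fun i => by split_ifs; exacts [E.2, (G.coeff (i-1)).2])
  set C := ∑ i ∈ Finset.range (G.natDegree + 1), K * (K+1) ^ i with hC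
  have hC0 : 0 ≤ C := Finset.sum_nonneg fun i _ => by positivity
  set ρ := max ρ0 (C + 1) with hρd
  have h1 : ρ0 ≤ ρ := le_max_left _ _
  have h2 : C + 1 ≤ ρ := le_max_right _ _
  have hρ : 0 < ρ := by linarith
  have hW := wt_wt hM.wt hρ
  have hE : ∀ N, nrm (wt M ρ) N E ≤ K := fun N => by
    simpa using hK ρ h1 N 0 (by simp)
  have hG : ∀ N, ∀ i ∈ Finset.range (G.natDegree + 1),
      nrm (wt M ρ) N (G.coeff i : PowerSeries ℂ) ≤ K := fun N i hi => by
    simpa using hK ρ h1 N (i+1) (by simp at hi ⊢; omega)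
  refine ⟨ρ, by linarith, K + 1, fun N => ?_⟩
  induction N with
  | zero => simp [nrm]; linarith
  | succ N ih =>
    rw [hv]
    refine (nrm_add hW _ _ _).trans ?_
    refine add_le_add (hE _) ((nrm_X_mul hM hρ N _).trans ?_)
    rw [inv_mul_le_iff₀ hρ, mul_one]
    refine le_trans ?_ (show C ≤ ρ by linarith)
    rw [Polynomial.aeval_eq_sum_range]
    refine (nrm_sum hW N _ _).trans (Finset.sum_le_sum fun i hi => ?_)
    have e : G.coeff i • v ^ i = (G.coeff i : PowerSeries ℂ) * v ^ i := rfl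
    rw [e]
    refine (nrm_mul hW N _ _).trans ?_
    have := nrm_nonneg hW N v
    refine mul_le_mul (hG N i hi) ((nrm_pow hW N i v).trans (by gcongr)) (nrm_nonneg hW _ _)
      (by linarith)

lemma exists_order {D : PowerSeries ℂ} (hD : D ≠ 0) :
    ∃ (m : ℕ) (D' : PowerSeries ℂ), D = PowerSeries.X ^ m * D' ∧ PowerSeries.coeff 0 D' ≠ 0 := by
  classical
  have hex : ∃ m, PowerSeries.coeff m D ≠ 0 := by
    by_contra hcon
    push Not at hcon
    exact hD (PowerSeries.ext (by simpa using hcon))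
  obtain ⟨D', hD'⟩ := (PowerSeries.X_pow_dvd_iff (n := Nat.find hex) (φ := D)).mpr
    (fun k hk => by simpa using Nat.find_min hex hk)
  refine ⟨Nat.find hex, D', hD', ?_⟩
  have h1 := Nat.find_spec hex
  have h2 := PowerSeries.coeff_X_pow_mul D' (Nat.find hex) 0
  rw [zero_add] at h2
  generalize Nat.find hex = n at *
  rw [← h2, ← hD']
  exact h1

lemma formal_root {M : ℕ → ℝ} {A : ℝ} (hM : SR M A) (Q : Polynomial (Lam M hM.wt))
    (y : PowerSeries ℂ) (h0 : Polynomial.aeval y Q = 0)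
    (h1 : Polynomial.aeval y (Polynomial.derivative Q) ≠ 0) : InLam M y := by
  obtain ⟨m, D', hD, hD'⟩ := exists_order h1
  set T0 : PowerSeries ℂ := PowerSeries.mk (fun k => if k < m + 1 then PowerSeries.coeff k y else 0)
    with hT0
  have hT : InLam M T0 := by
    apply InLam.of_finite hM (L := m+1)
    intro k hk
    rw [hT0, PowerSeries.coeff_mk, if_neg (by omega)]
  set T : Lam M hM.wt := ⟨T0, hT⟩ with hTd
  obtain ⟨v, hv⟩ : PowerSeries.X ^ (m+1) ∣ y - T0 := by
    rw [PowerSeries.X_pow_dvd_iff]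
    intro k hk
    rw [hT0, map_sub, PowerSeries.coeff_mk, if_pos hk, sub_self]
  set R := Polynomial.taylor T Q with hR
  set q0 : Lam M hM.wt := R.coeff 0
  set q1 : Lam M hM.wt := R.coeff 1
  set R2 := R.divX.divX with hR2
  have hRdec : R = (R2 * Polynomial.X + Polynomial.C q1) * Polynomial.X + Polynomial.C q0 := by
    have e1 := Polynomial.divX_mul_X_add R
    have e2 := Polynomial.divX_mul_X_add R.divX
    rw [Polynomial.coeff_divX] at e2
    conv_lhs => rw [← e1, ← e2]
  have hev : Polynomial.aeval (PowerSeries.X ^ (m+1) * v) R = 0 := by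
    rw [hR, Polynomial.taylor_apply, Polynomial.aeval_comp]
    rw [← hv]
    simp only [map_add, Polynomial.aeval_X, Polynomial.aeval_C]
    have : y - T0 + algebraMap (Lam M hM.wt) (PowerSeries ℂ) T = y := by
      change y - T0 + T0 = y
      ring
    rw [this, h0]
  set u := PowerSeries.X ^ (m+1) * v with hu
  set r2 := Polynomial.aeval u R2 with hr2
  have hev2 : (r2 * u + q1) * u + (q0 : PowerSeries ℂ) = 0 := by
    rw [hRdec] at hev
    simp only [map_add, map_mul, Polynomial.aeval_X, Polynomial.aeval_C] at hev
    exact hev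
  have hq1 : ∃ s, (q1 : PowerSeries ℂ) = PowerSeries.X ^ m * (D' - PowerSeries.X * s) := by
    have e1 : (q1 : PowerSeries ℂ) = Polynomial.aeval T0 (Polynomial.derivative Q) := by
      have : q1 = (Polynomial.derivative Q).eval T := Polynomial.taylor_coeff_one T Q
      rw [this]
      have := Polynomial.aeval_algebraMap_apply_eq_algebraMap_eval (A := PowerSeries ℂ) T
        (Polynomial.derivative Q)
      exact this.symm
    obtain ⟨s, hs⟩ := Polynomial.sub_dvd_eval_sub y T0
      ((Polynomial.derivative Q).map (algebraMap (Lam M hM.wt) (PowerSeries ℂ)))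
    rw [Polynomial.eval_map_algebraMap, Polynomial.eval_map_algebraMap, ← e1, hD, hv] at hs
    refine ⟨v * s, ?_⟩
    rw [hu] at hs
    linear_combination -hs
  obtain ⟨s, hq1⟩ := hq1
  set q1' := D' - PowerSeries.X * s with hq1'
  have hq1m : InLam M q1' := InLam.shift hM m (by rw [← hq1]; exact q1.2)
  set c0 := PowerSeries.coeff 0 q1' with hc0
  have hc0ne : c0 ≠ 0 := by
    rw [hc0, hq1', map_sub, PowerSeries.coeff_zero_X_mul, sub_zero]; exact hD'
  have hconst : ∀ c : ℂ, InLam M (PowerSeries.C c) := fun c =>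
    InLam.of_finite hM (L := 1) (fun k hk => by
      rw [PowerSeries.coeff_C, if_neg (by omega)])
  obtain ⟨e, he⟩ : PowerSeries.X ∣ q1' - PowerSeries.C c0 := by
    rw [PowerSeries.X_dvd_iff, map_sub]
    simp [hc0]
  have hem : InLam M e := by
    apply InLam.shift hM 1
    rw [pow_one, ← he]
    exact (Lam M hM.wt).sub_mem hq1m (hconst c0)
  have hq0m : InLam M (-v * (q1' + PowerSeries.X * v * r2)) := by
    apply InLam.shift hM (2*m+1)
    have : PowerSeries.X ^ (2*m+1) * (-v * (q1' + PowerSeries.X * v * r2)) = (q0 : PowerSeries ℂ) := by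
      rw [hq1, hu] at hev2
      linear_combination -hev2
    rw [this]; exact q0.2
  set q0' := -v * (q1' + PowerSeries.X * v * r2) with hq0'
  have hXm : InLam M (PowerSeries.X ^ (m+1) : PowerSeries ℂ) := by
    apply InLam.of_finite hM (L := m+2)
    intro k hk
    rw [PowerSeries.coeff_X_pow, if_neg (by omega)]
  have hcc : PowerSeries.C c0⁻¹ * PowerSeries.C c0 = (1 : PowerSeries ℂ) := by
    rw [← map_mul, inv_mul_cancel₀ hc0ne, map_one]
  let ci : Lam M hM.wt := ⟨PowerSeries.C c0⁻¹, hconst _⟩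
  let eL : Lam M hM.wt := ⟨e, hem⟩
  let xm : Lam M hM.wt := ⟨PowerSeries.X ^ (m+1), hXm⟩
  let q0L : Lam M hM.wt := ⟨q0', hq0m⟩
  have hvL : InLam M v := by
    apply formal_solve hM (-ci * q0L)
      (-Polynomial.C ci * (Polynomial.C eL * Polynomial.X + Polynomial.X ^ 2 *
        R2.comp (Polynomial.C xm * Polynomial.X)))
    have hcomp : Polynomial.aeval v (R2.comp (Polynomial.C xm * Polynomial.X)) = r2 := by
      rw [Polynomial.aeval_comp, map_mul, Polynomial.aeval_C, Polynomial.aeval_X]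
      rfl
    have e1 : ((-ci * q0L : Lam M hM.wt) : PowerSeries ℂ) = - PowerSeries.C c0⁻¹ * q0' := rfl
    have e2 : algebraMap (Lam M hM.wt) (PowerSeries ℂ) ci = PowerSeries.C c0⁻¹ := rfl
    have e3 : algebraMap (Lam M hM.wt) (PowerSeries ℂ) eL = e := rfl
    rw [e1, map_mul, map_add, map_mul, map_mul, hcomp, map_neg, Polynomial.aeval_C,
      Polynomial.aeval_C, map_pow, Polynomial.aeval_X, e2, e3, hq0']
    have he' : q1' = PowerSeries.C c0 + PowerSeries.X * e := by rw [← he]; ring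
    rw [he']
    linear_combination (-v) * hcc
  have : y = T0 + PowerSeries.X ^ (m+1) * v := by rw [← hu, ← hv]; ring
  rw [this]
  exact (Lam M hM.wt).add_mem hT ((Lam M hM.wt).mul_mem hXm hvL)

/-- The monic polynomial with given lower coefficients. -/
def gen {R : Type*} [CommRing R] (d : ℕ) (α : Fin d → R) : Polynomial R :=
  Polynomial.X ^ d + ∑ i : Fin d, Polynomial.C (α i) * Polynomial.X ^ (d - 1 - (i : ℕ))

lemma gen_map {R S : Type*} [CommRing R] [CommRing S] (φ : R →+* S) (d : ℕ) (α : Fin d → R) :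
    (gen d α).map φ = gen d (fun i => φ (α i)) := by
  simp [gen, Polynomial.map_sum]

lemma gen_eval {R : Type*} [CommRing R] (d : ℕ) (α : Fin d → R) (x : R) :
    (gen d α).eval x = x ^ d + ∑ i : Fin d, α i * x ^ (d - 1 - (i : ℕ)) := by
  simp [gen, Polynomial.eval_finsetSum]

lemma gen_tay {R : Type*} [CommRing R] (d : ℕ) (α : Fin d → R) (H : R) (j : ℕ) :
    (Polynomial.taylor H (gen d α)).coeff j = H ^ (d - j) * (d.choose j : R) +
      ∑ i : Fin d, α i * (H ^ (d - 1 - (i : ℕ) - j) * ((d - 1 - (i : ℕ)).choose j : R)) := by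
  simp [gen, Polynomial.coeff_X_add_C_pow, map_sum]

lemma gen_tay_map {R S : Type*} [CommRing R] [CommRing S] (φ : R →+* S) (d : ℕ) (α : Fin d → R)
    (H : R) (j : ℕ) : φ ((Polynomial.taylor H (gen d α)).coeff j) =
      (Polynomial.taylor (φ H) (gen d (fun i => φ (α i)))).coeff j := by
  rw [gen_tay, gen_tay]; simp [map_sum]

lemma gen_tay_top {R : Type*} [CommRing R] {d : ℕ} (_hd : 1 ≤ d) (α : Fin d → R) (H : R) :
    (Polynomial.taylor H (gen d α)).coeff d = 1 := by
  rw [gen_tay]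
  rw [Finset.sum_eq_zero]
  · simp
  · intro i _
    rw [Nat.choose_eq_zero_of_lt (by omega)]; simp

lemma gen_tay_gt {R : Type*} [CommRing R] {d : ℕ} (α : Fin d → R) (H : R) {j : ℕ}
    (hj : d < j) : (Polynomial.taylor H (gen d α)).coeff j = 0 := by
  rw [gen_tay]
  rw [Finset.sum_eq_zero]
  · rw [Nat.choose_eq_zero_of_lt (by omega)]; simp
  · intro i _
    rw [Nat.choose_eq_zero_of_lt (by omega)]; simp

lemma gen_tay_sum {R : Type*} [CommRing R] {d : ℕ} (α : Fin d → R) (H w : R) :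
    ∑ j ∈ Finset.range (d+1), (Polynomial.taylor H (gen d α)).coeff j * w ^ j =
      (gen d α).eval (w + H) := by
  rw [← Polynomial.taylor_eval, Polynomial.eval_eq_sum_range']
  by_contra hcon
  push Not at hcon
  have h1 := gen_tay_gt α H (j := (Polynomial.taylor H (gen d α)).natDegree) (by omega)
  rw [Polynomial.coeff_natDegree, Polynomial.leadingCoeff_eq_zero] at h1
  rw [h1] at hcon; simp at hcon

/-- The constant in the bound of Taylor coefficients. -/
def Cst (d : ℕ) (K : ℝ) : ℝ := K ^ d * 2 ^ d + d * (K * (K ^ d * 2 ^ d))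

lemma Cst_ge {d : ℕ} {K : ℝ} (hK : 1 ≤ K) : 1 ≤ Cst d K := by
  unfold Cst
  have h1 : 1 ≤ K ^ d := one_le_pow₀ hK
  have h2 : (1:ℝ) ≤ 2 ^ d := one_le_pow₀ (by norm_num)
  have : 0 ≤ (d:ℝ) * (K * (K ^ d * 2 ^ d)) := by positivity
  nlinarith

lemma tay_bound {R : Type*} [CommRing R] (ν : R → ℝ) (h0 : ν 0 = 0) (h1 : ν 1 ≤ 1)
    (hnn : ∀ x, 0 ≤ ν x) (hadd : ∀ x y, ν (x + y) ≤ ν x + ν y)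
    (hmul : ∀ x y, ν (x * y) ≤ ν x * ν y) {K : ℝ} (hK : 1 ≤ K) (d : ℕ) (α : Fin d → R) (H : R)
    (hα : ∀ i, ν (α i) ≤ K) (hH : ν H ≤ K) (j : ℕ) :
    ν ((Polynomial.taylor H (gen d α)).coeff j) ≤ Cst d K := by
  have hnat : ∀ m : ℕ, ν (m : R) ≤ m := by
    intro m
    induction m with
    | zero => simp [h0]
    | succ m ih => push_cast; exact (hadd _ _).trans (by linarith)
  have hpow : ∀ m : ℕ, ν (H ^ m) ≤ K ^ m := by
    intro m
    induction m with
    | zero => simpa using h1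
    | succ m ih =>
      rw [pow_succ, pow_succ]
      refine (hmul _ _).trans ?_
      have := hnn H
      gcongr
  have hsum : ∀ (s : Finset (Fin d)) (f : Fin d → R), ν (∑ i ∈ s, f i) ≤ ∑ i ∈ s, ν (f i) := by
    intro s f
    induction s using Finset.induction_on with
    | empty => simp [h0]
    | insert a s ha ih =>
      rw [Finset.sum_insert ha, Finset.sum_insert ha]
      exact (hadd _ _).trans (by linarith)
  have key : ∀ e i : ℕ, e ≤ d → ν (H ^ (e - i) * (e.choose i : R)) ≤ K ^ d * 2 ^ d := by
    intro e i he
    have hc : ((e.choose i : ℕ) : ℝ) ≤ 2 ^ d := by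
      calc ((e.choose i : ℕ) : ℝ) ≤ 2 ^ e := by exact_mod_cast Nat.choose_le_two_pow e i
        _ ≤ 2 ^ d := pow_le_pow_right₀ (by norm_num) he
    refine (hmul _ _).trans ?_
    have a1 : ν (H ^ (e - i)) ≤ K ^ d := (hpow _).trans (pow_le_pow_right₀ hK (by omega))
    have a2 := (hnat (e.choose i)).trans hc
    have := hnn (H ^ (e - i))
    have := hnn ((e.choose i : ℕ) : R)
    gcongr
  rw [gen_tay]
  refine (hadd _ _).trans ?_
  unfold Cst
  refine add_le_add (key d j le_rfl) ((hsum _ _).trans ?_)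
  calc _ ≤ ∑ i : Fin d, K * (K ^ d * 2 ^ d) := by
        apply Finset.sum_le_sum
        intro i _
        refine (hmul _ _).trans ?_
        have := hnn (H ^ (d - 1 - (i : ℕ) - j) * ((d - 1 - (i : ℕ)).choose j : R))
        exact mul_le_mul (hα i) (key _ _ (by omega)) this (by linarith)
    _ = _ := by simp

lemma nu_taylor {W : ℕ → ℝ} (hW : Wt W) {N : ℕ} (h1 : 1 ≤ N) {z : ℂ} (hz : 0 < ‖z‖)
    (hN : ∀ i < N, ‖z‖ * W (i+1) ≤ W i) {K : ℝ} (hK : 1 ≤ K) (d : ℕ)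
    (α : Fin d → ℂ × PowerSeries ℂ) (H : ℂ × PowerSeries ℂ)
    (hα : ∀ i, nu W N z (α i) ≤ K) (hH : nu W N z H ≤ K) (j : ℕ) :
    nu W N z ((Polynomial.taylor H (gen d α)).coeff j) ≤ Cst d K :=
  tay_bound _ (nu_zero N z) (nu_one hW h1 z).le (nu_nonneg hW N z) (nu_add hW N z)
    (fun p q => nu_mul hW N p q hz hN) hK d α H hα hH j

lemma neBot_Sec {c R : ℝ} (hc1 : c < 1) (hR : 0 < R) : (𝓝[Sec c R] (0:ℂ)).NeBot := by
  have h1 : ((R/2 : ℝ) : ℂ) ∈ Sec c R := Sec_real hc1 (by linarith) (by linarith)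
  have := neBot_ray
  exact (tendsto_ray h1).neBot

lemma expansion {c R : ℝ} (hc : |c| ≤ 1) (hc1 : c < 1) (hR : 0 < R) {f : ℂ → ℂ}
    (hf : DifferentiableOn ℂ f (Sec c R))
    (hb : ∀ j : ℕ, ∃ B : ℝ, ∀ z ∈ Sec c R, ‖iteratedDeriv j f z‖ ≤ B) :
    ∃ x : PowerSeries ℂ, ∀ (N : ℕ) (B : ℝ), (∀ z ∈ Sec c R, ‖iteratedDeriv N f z‖ ≤ B) →
      (∀ z ∈ Sec c R, ‖f z - tv N x z‖ ≤ B / N.factorial * ‖z‖ ^ N) ∧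
      ‖PowerSeries.coeff N x‖ ≤ B / N.factorial := by
  have hF : ∀ j, ∀ z ∈ Sec c R, HasDerivAt (iteratedDeriv j f) (iteratedDeriv (j+1) f z) z :=
    fun j z hz => hasDerivAt_iter (isOpen_Sec c R) hf j hz
  have hlim : ∀ j, ∃ L, Tendsto (iteratedDeriv j f) (𝓝[Sec c R] 0) (𝓝 L) := by
    intro j
    obtain ⟨B, hB⟩ := hb (j+1)
    exact exists_limit hc hc1 hR (hF j) hB
  choose L hL using hlim
  refine ⟨PowerSeries.mk fun k => L k / (k.factorial : ℂ), fun N B hB => ⟨fun z hz => ?_, ?_⟩⟩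
  · have := taylor_vertex hF hL N 0 B (by simpa using hB) z hz
    simpa [tv] using this
  · have := neBot_Sec hc1 hR
    have h1 : ‖L N‖ ≤ B := by
      refine le_of_tendsto (hL N).norm ?_
      filter_upwards [self_mem_nhdsWithin] with z hz using hB z hz
    rw [PowerSeries.coeff_mk, norm_div, Complex.norm_natCast]
    gcongr

lemma ser_zero {c R : ℝ} (hc1 : c < 1) (hR : 0 < R) {x : PowerSeries ℂ}
    (h : ∀ N, ∃ B, ∀ z ∈ Sec c R, ‖tv N x z‖ ≤ B * ‖z‖ ^ N) : x = 0 := by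
  ext n
  induction n using Nat.strong_induction_on with
  | _ n ih =>
    obtain ⟨B, hB⟩ := h (n+1)
    have h1 : ∀ p : ℝ, p ∈ Ioo 0 R → ‖PowerSeries.coeff n x‖ ≤ B * p := by
      intro p hp
      have h2 := hB (p : ℂ) (Sec_real hc1 hp.1 hp.2)
      rw [tv, Finset.sum_range_succ, Finset.sum_eq_zero] at h2
      · rw [zero_add, norm_mul, norm_pow, Complex.norm_real, Real.norm_of_nonneg hp.1.le,
          pow_succ] at h2
        have : 0 < p ^ n := pow_pos hp.1 n
        refine le_of_mul_le_mul_right ?_ this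
        linarith
      · intro k hk
        rw [ih k (Finset.mem_range.1 hk)]; simp
    have h3 : ‖PowerSeries.coeff n x‖ ≤ 0 := by
      have ht : Tendsto (fun p : ℝ => B * p) (𝓝[>] 0) (𝓝 (B * 0)) :=
        (tendsto_nhdsWithin_of_tendsto_nhds tendsto_id).const_mul B
      rw [mul_zero] at ht
      refine ge_of_tendsto ht ?_
      filter_upwards [Ioo_mem_nhdsGT hR] with p hp using h1 p hp
    simpa using h3

lemma geo_wt {q : ℝ} (hq : 0 < q) : Wt (fun i => q ^ i) where
  pos i := by positivity
  zero := by simp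
  lc i := by apply le_of_eq; ring

lemma nu_pair_le {W : ℕ → ℝ} (hW : Wt W) {N : ℕ} {x : PowerSeries ℂ} {v z : ℂ} {B : ℝ}
    (hz : 0 < ‖z‖) (hB : ‖v - tv N x z‖ ≤ B * ‖z‖ ^ N) :
    nu W N z (v, x) ≤ nrm W N x + B / W N := by
  have hWN := hW.pos N
  unfold nu
  simp only
  apply add_le_add le_rfl
  rw [div_le_div_iff₀ (by positivity) hWN]
  calc _ ≤ B * ‖z‖ ^ N * W N := by gcongr
    _ = _ := by ring

lemma beta_zero {c R : ℝ} (hc1 : c < 1) (hR : 0 < R) {d : ℕ}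
    {a : Fin d → ℂ → ℂ} {h : ℂ → ℂ} {α : Fin d → PowerSeries ℂ} {y : PowerSeries ℂ}
    (ha : ∀ i N, ∃ B, ∀ z ∈ Sec c R, ‖a i z - tv N (α i) z‖ ≤ B * ‖z‖ ^ N)
    (hh : ∀ N, ∃ B, ∀ z ∈ Sec c R, ‖h z - tv N y z‖ ≤ B * ‖z‖ ^ N)
    (heq : ∀ z ∈ Sec c R, h z ^ d + ∑ i : Fin d, a i z * h z ^ (d - 1 - (i : ℕ)) = 0) :
    (Polynomial.taylor y (gen d α)).coeff 0 = 0 := by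
  apply ser_zero hc1 hR
  intro N
  rcases Nat.eq_zero_or_pos N with rfl | hNpos
  · exact ⟨0, fun z _ => by simp [tv]⟩
  have hq : 0 < R⁻¹ := by positivity
  have hW := geo_wt hq
  set W : ℕ → ℝ := fun i => R⁻¹ ^ i with hWdef
  have hWN := hW.pos N
  choose Ba hBa using fun i => ha i N
  obtain ⟨Bh, hBh⟩ := hh N
  have nb := fun (x : PowerSeries ℂ) (v z : ℂ) (B : ℝ) => nu_pair_le hW (N := N) (x := x) (v := v)
    (z := z) (B := B)
  set K : ℝ := max 1 (max (nrm W N y + Bh / W N) (∑ i, |nrm W N (α i) + Ba i / W N|)) with hKdef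
  refine ⟨Cst d K * W N, fun z hz => ?_⟩
  have hz0 := Sec_ne_zero hz
  have hK1 : 1 ≤ K := le_max_left _ _
  have key := nu_taylor hW hNpos hz0 (N := N) (by
    intro i _
    have : ‖z‖ * R⁻¹ ≤ 1 := by
      rw [← div_eq_mul_inv, div_le_one hR]; exact hz.2.le
    simp only [hWdef]
    rw [pow_succ]
    have : 0 < R⁻¹ ^ i := by positivity
    nlinarith) hK1 d (fun i => (a i z, α i)) (h z, y)
    (fun i => (nb _ _ _ _ hz0 (hBa i z hz)).trans ((le_abs_self _).trans
      ((Finset.single_le_sum (f := fun i => |nrm W N (α i) + Ba i / W N|)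
        (fun i _ => abs_nonneg _) (Finset.mem_univ i)).trans
        ((le_max_right _ _).trans (le_max_right _ _)))))
    ((nb _ _ _ _ hz0 (hBh z hz)).trans ((le_max_left _ _).trans (le_max_right _ _))) 0
  have e1 := gen_tay_map (RingHom.fst ℂ (PowerSeries ℂ)) d (fun i => (a i z, α i)) (h z, y) 0
  have e2 := gen_tay_map (RingHom.snd ℂ (PowerSeries ℂ)) d (fun i => (a i z, α i)) (h z, y) 0
  simp only [RingHom.coe_fst, RingHom.coe_snd] at e1 e2
  rw [Polynomial.taylor_coeff_zero (r := h z), gen_eval d _ (h z), heq z hz] at e1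
  unfold nu at key
  rw [e1, e2, zero_sub, norm_neg] at key
  have h1 := nrm_nonneg hW N ((Polynomial.taylor y (gen d α)).coeff 0)
  have h2 : ‖tv N ((Polynomial.taylor y (gen d α)).coeff 0) z‖ / (W N * ‖z‖ ^ N) ≤ Cst d K := by
    linarith
  rw [div_le_iff₀ (by positivity)] at h2
  linarith

lemma root_in_Lam {M : ℕ → ℝ} {A : ℝ} (hM : SR M A) {d : ℕ} (α : Fin d → PowerSeries ℂ)
    (hα : ∀ i, InLam M (α i)) (y : PowerSeries ℂ) (k : ℕ)
    (h0 : (Polynomial.taylor y (gen d α)).coeff k = 0)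
    (h1 : (Polynomial.taylor y (gen d α)).coeff (k+1) ≠ 0) : InLam M y := by
  set φ : Lam M hM.wt →+* PowerSeries ℂ := (Lam M hM.wt).subtype with hφ
  set P : Polynomial (Lam M hM.wt) := gen d (fun i => ⟨α i, hα i⟩) with hP
  have hmap : P.map φ = gen d α := by rw [hP, gen_map]; rfl
  have hae : ∀ Q : Polynomial (Lam M hM.wt), Polynomial.aeval y Q = (Q.map φ).eval y := by
    intro Q
    rw [Polynomial.eval_map, Polynomial.aeval_def]; rfl
  have hH : ∀ j, (Polynomial.hasseDeriv j P).map φ = Polynomial.hasseDeriv j (gen d α) := by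
    intro j
    rw [← hmap]
    ext n : 1
    simp [Polynomial.hasseDeriv_coeff]
  apply formal_root hM (Polynomial.hasseDeriv k P) y
  · rw [hae, hH, ← Polynomial.taylor_coeff]; exact h0
  · have e : Polynomial.derivative (Polynomial.hasseDeriv k P) =
        (k+1) • Polynomial.hasseDeriv (k+1) P := by
      rw [← Polynomial.hasseDeriv_one']
      have := LinearMap.congr_fun (Polynomial.hasseDeriv_comp (R := Lam M hM.wt) 1 k) P
      simp only [LinearMap.comp_apply, LinearMap.smul_apply] at this
      rw [this, add_comm 1 k]; simp
    rw [e, map_nsmul, hae, hH, ← Polynomial.taylor_coeff]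
    intro hc
    apply h1
    ext n
    have h2 := congrArg (PowerSeries.coeff n) hc
    rw [map_nsmul, nsmul_eq_mul, map_zero] at h2
    rw [map_zero]
    exact (mul_eq_zero.1 h2).resolve_left (Nat.cast_ne_zero.2 (Nat.succ_ne_zero k))

lemma small_root {d k : ℕ} (hk : k ≤ d) {b : ℕ → ℂ} {w : ℂ} {K ε : ℝ} (hε : 0 ≤ ε) (hK : 0 ≤ K)
    (hsum : ∑ j ∈ Finset.range (d+1), b j * w ^ j = 0) (hlow : ∀ j < k, ‖b j‖ ≤ ε)
    (hall : ∀ j, ‖b j‖ ≤ K) (hw : ‖w‖ ≤ 1) :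
    ‖b k‖ * ‖w‖ ^ k ≤ (d+1) * ε + (d+1) * K * ‖w‖ ^ (k+1) := by
  rw [← Finset.add_sum_erase _ _ (Finset.mem_range.2 (show k < d+1 by omega))] at hsum
  have h1 : b k * w ^ k = -∑ j ∈ (Finset.range (d+1)).erase k, b j * w ^ j := by
    linear_combination hsum
  rw [← norm_pow, ← norm_mul, h1, norm_neg]
  have h2 : ∀ j ∈ (Finset.range (d+1)).erase k, ‖b j * w ^ j‖ ≤ ε + K * ‖w‖ ^ (k+1) := by
    intro j hj
    rw [norm_mul, norm_pow]
    have hw0 := norm_nonneg w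
    rcases lt_or_gt_of_ne (Finset.ne_of_mem_erase hj) with h | h
    · have a1 : ‖w‖ ^ j ≤ 1 := pow_le_one₀ hw0 hw
      have a2 := hlow j h
      have a3 : 0 ≤ K * ‖w‖ ^ (k+1) := by positivity
      have a4 : ‖b j‖ * ‖w‖ ^ j ≤ ε * 1 := by gcongr
      linarith
    · have a1 : ‖w‖ ^ j ≤ ‖w‖ ^ (k+1) := pow_le_pow_of_le_one hw0 hw (by omega)
      have a4 : ‖b j‖ * ‖w‖ ^ j ≤ K * ‖w‖ ^ (k+1) := by
        have := hall j
        gcongr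
      linarith
  refine (norm_sum_le _ _).trans ((Finset.sum_le_card_nsmul _ _ _ h2).trans ?_)
  rw [nsmul_eq_mul]
  have h3 : (((Finset.range (d+1)).erase k).card : ℝ) ≤ d + 1 := by
    have := Finset.card_erase_le (s := Finset.range (d+1)) (a := k)
    rw [Finset.card_range] at this
    exact_mod_cast this
  have a3 : 0 ≤ ε + K * ‖w‖ ^ (k+1) := by positivity
  nlinarith

lemma M_kn {M : ℕ → ℝ} {A : ℝ} (hM : SR M A) (k n q : ℕ) :
    M (k*n+q) ≤ (A ^ (k*n+q)) ^ k * (M n) ^ k * M q := by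
  have hA := hM.one_le
  induction k with
  | zero => simp
  | succ k ih =>
    have h1 := hM.mg n (k*n+q)
    have e : (k+1)*n+q = n + (k*n+q) := by ring
    have p1 := hM.wt.pos n
    have p2 := hM.wt.pos q
    rw [e]
    calc M (n + (k*n+q)) ≤ A ^ (n+(k*n+q)) * (M n * M (k*n+q)) := h1
      _ ≤ A ^ (n+(k*n+q)) * (M n * ((A ^ (k*n+q)) ^ k * (M n) ^ k * M q)) := by gcongr
      _ ≤ A ^ (n+(k*n+q)) * (M n * ((A ^ (n+(k*n+q))) ^ k * (M n) ^ k * M q)) := by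
          have : A ^ (k*n+q) ≤ A ^ (n+(k*n+q)) := pow_le_pow_right₀ hA (by omega)
          gcongr A ^ (n+(k*n+q)) * (M n * (?_ ^ k * _ * _))
      _ = _ := by ring

lemma tv_ord (m : ℕ) (D' : PowerSeries ℂ) (z : ℂ) :
    tv (m+1) (PowerSeries.X ^ m * D') z = PowerSeries.coeff 0 D' * z ^ m := by
  rw [tv, Finset.sum_range_succ, Finset.sum_eq_zero, zero_add]
  · have h2 := PowerSeries.coeff_X_pow_mul D' m 0
    rw [zero_add] at h2
    rw [h2]
  · intro k hk
    rw [PowerSeries.coeff_X_pow_mul', if_neg (by simpa using hk)]; simp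

lemma pointwise {W : ℕ → ℝ} (hW : Wt W) {N m k d : ℕ} (hmN : m + 1 ≤ N) {z : ℂ} (hz : 0 < ‖z‖)
    (hN : ∀ i < N, ‖z‖ * W (i+1) ≤ W i) {K : ℝ} (hK : 1 ≤ K) {α : Fin d → PowerSeries ℂ}
    {y D' : PowerSeries ℂ} {av : Fin d → ℂ} {v : ℂ} (hA : ∀ i, nu W N z (av i, α i) ≤ K)
    (hy : nrm W N y ≤ K) (hv : (gen d av).eval v = 0)
    (hlow : ∀ j < k, (Polynomial.taylor y (gen d α)).coeff j = 0) (hkd : k ≤ d)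
    (hord : (Polynomial.taylor y (gen d α)).coeff k = PowerSeries.X ^ m * D')
    (hw : ‖v - tv N y z‖ ≤ 1) :
    (‖PowerSeries.coeff 0 D'‖ * ‖z‖ ^ m - Cst d K * (W (m+1) * ‖z‖ ^ (m+1)))
        * ‖v - tv N y z‖ ^ k ≤
      (d+1) * (Cst d K * (W N * ‖z‖ ^ N)) + (d+1) * Cst d K * ‖v - tv N y z‖ ^ (k+1) := by
  set K2 := Cst d K with hK2
  have hK21 : 1 ≤ K2 := Cst_ge hK
  set H : ℂ × PowerSeries ℂ := (tv N y z, y) with hH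
  have hHn : nu W N z H ≤ K := by simpa [nu, hH] using hy
  set Bc : ℕ → ℂ × PowerSeries ℂ := fun j =>
    (Polynomial.taylor H (gen d (fun i => (av i, α i)))).coeff j with hBc
  have hB : ∀ j, nu W N z (Bc j) ≤ K2 := fun j =>
    nu_taylor hW (by omega) hz hN hK d _ H hA hHn j
  have hB2 : ∀ j, (Bc j).2 = (Polynomial.taylor y (gen d α)).coeff j := fun j =>
    gen_tay_map (RingHom.snd ℂ (PowerSeries ℂ)) d (fun i => (av i, α i)) H j
  have hB1 : ∀ j, (Bc j).1 = (Polynomial.taylor (tv N y z) (gen d av)).coeff j := fun j =>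
    gen_tay_map (RingHom.fst ℂ (PowerSeries ℂ)) d (fun i => (av i, α i)) H j
  have htail : ∀ j n, n ≤ N → ‖(Bc j).1 - tv n (Bc j).2 z‖ ≤ K2 * (W n * ‖z‖ ^ n) := by
    intro j n hn
    refine (tail_le hW hn (Bc j) hz hN).trans ?_
    have := hW.pos n
    have := hB j
    gcongr
  have hWN := hW.pos N
  have hsum : ∑ j ∈ Finset.range (d+1), (Bc j).1 * (v - tv N y z) ^ j = 0 := by
    simp only [hB1]
    rw [gen_tay_sum, sub_add_cancel, hv]
  have h1 := small_root hkd (b := fun j => (Bc j).1) (w := v - tv N y z) (K := K2)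
    (ε := K2 * (W N * ‖z‖ ^ N)) (by positivity) (by linarith) hsum
    (by
      intro j hj
      have := htail j N le_rfl
      rw [hB2, hlow j hj] at this
      simpa [tv] using this)
    (by
      intro j
      have := htail j 0 (Nat.zero_le _)
      simpa [tv, hW.zero] using this) hw
  have h2 := htail k (m+1) hmN
  rw [hB2, hord, tv_ord] at h2
  have h3 : ‖PowerSeries.coeff 0 D'‖ * ‖z‖ ^ m - K2 * (W (m+1) * ‖z‖ ^ (m+1)) ≤ ‖(Bc k).1‖ := by
    have h4 := norm_sub_norm_le (PowerSeries.coeff 0 D' * z ^ m) (Bc k).1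
    have h5 : ‖PowerSeries.coeff 0 D' * z ^ m‖ = ‖PowerSeries.coeff 0 D'‖ * ‖z‖ ^ m := by
      rw [norm_mul, norm_pow]
    have h6 := norm_sub_rev (PowerSeries.coeff 0 D' * z ^ m) (Bc k).1
    linarith
  exact (mul_le_mul_of_nonneg_right h3 (by positivity)).trans h1

lemma wt_down {M : ℕ → ℝ} (hM : Wt M) {ρ t : ℝ} (hρ : 0 < ρ) (ht : 0 ≤ t) {n : ℕ}
    (h : t * (ρ * M (n+1)) ≤ M n) : ∀ i < n + 1, t * wt M ρ (i+1) ≤ wt M ρ i := by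
  intro i hi
  obtain ⟨l, rfl⟩ : ∃ l, n = i + l := ⟨n - i, by omega⟩
  have h1 := hM.ratio i l
  have p0 := hM.pos i
  have p1 := hM.pos (i+l)
  have p2 := hM.pos (i+1)
  have h2 : t * (ρ * M (i+1)) ≤ M i := by
    refine le_of_mul_le_mul_right ?_ p1
    calc t * (ρ * M (i+1)) * M (i+l) = t * ρ * (M (i+1) * M (i+l)) := by ring
      _ ≤ t * ρ * (M i * M (i+l+1)) := by gcongr
      _ = t * (ρ * M (i+l+1)) * M i := by ring
      _ ≤ M (i+l) * M i := by gcongr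
      _ = _ := by ring
  unfold wt
  calc t * (M (i+1) * ρ ^ (i+1)) = t * (ρ * M (i+1)) * ρ ^ i := by ring
    _ ≤ _ := by gcongr

lemma exists_small {a b s : ℝ} (hs : 0 < s) (ha : 0 ≤ a) (hb : 0 ≤ b) :
    ∃ δ : ℝ, 0 < δ ∧ δ ≤ 1 ∧ δ * a ≤ 1 ∧ δ * b ≤ s := by
  refine ⟨min 1 s / (1 + a + b), by positivity, ?_, ?_, ?_⟩
  · rw [div_le_one (by positivity)]
    exact (min_le_left _ _).trans (by linarith)
  · rw [div_mul_eq_mul_div, div_le_one (by positivity)]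
    have := min_le_left 1 s
    nlinarith
  · rw [div_mul_eq_mul_div, div_le_iff₀ (by positivity)]
    have := min_le_right 1 s
    nlinarith

set_option maxHeartbeats 2000000 in
lemma core {c R : ℝ} (hc1 : c < 1) (hR : 0 < R) {M : ℕ → ℝ} {A : ℝ} (hM : SR M A)
    {d : ℕ} (hd : 1 ≤ d)
    {a : Fin d → ℂ → ℂ} {h : ℂ → ℂ} {α : Fin d → PowerSeries ℂ} {y : PowerSeries ℂ} {C0 σ0 : ℝ}
    (hC0 : 1 ≤ C0) (hσ0 : 1 ≤ σ0)
    (ha : ∀ i N, ∀ z ∈ Sec c R, ‖a i z - tv N (α i) z‖ ≤ C0 * σ0 ^ N * M N * ‖z‖ ^ N)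
    (hα : ∀ i N, ‖PowerSeries.coeff N (α i)‖ ≤ C0 * σ0 ^ N * M N)
    (hh : ∀ N, ∃ B, ∀ z ∈ Sec c R, ‖h z - tv N y z‖ ≤ B * ‖z‖ ^ N)
    (heq : ∀ z ∈ Sec c R, h z ^ d + ∑ i : Fin d, a i z * h z ^ (d - 1 - (i : ℕ)) = 0) :
    ∃ (k m : ℕ) (ρ δ C σ : ℝ), 1 ≤ k ∧ 1 ≤ ρ ∧ 0 < δ ∧ 0 ≤ C ∧ 1 ≤ σ ∧
      ∀ n, ∀ z ∈ Sec c R, ‖z‖ ≤ δ → ‖z‖ * (ρ * M (k*n+m+1)) ≤ M (k*n+m) →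
        ‖h z - tv n y z‖ ≤ C * σ ^ n * M n * ‖z‖ ^ n := by
  have hA1 := hM.one_le
  have hb0 := beta_zero hc1 hR (fun i N => ⟨_, ha i N⟩) hh heq
  have hex : ∃ k, (Polynomial.taylor y (gen d α)).coeff k ≠ 0 :=
    ⟨d, by rw [gen_tay_top hd]; exact one_ne_zero⟩
  classical
  obtain ⟨k, hkne, hlow⟩ : ∃ k, (Polynomial.taylor y (gen d α)).coeff k ≠ 0 ∧
      ∀ j < k, (Polynomial.taylor y (gen d α)).coeff j = 0 :=
    ⟨Nat.find hex, Nat.find_spec hex, fun j hj => not_not.1 (Nat.find_min hex hj)⟩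
  have hk1 : 1 ≤ k := by
    rcases Nat.eq_zero_or_pos k with rfl | hk
    · exact absurd hb0 hkne
    · exact hk
  have hkd : k ≤ d := by
    by_contra hcon
    exact hkne (gen_tay_gt _ _ (by omega))
  have hαL : ∀ i, InLam M (α i) := fun i => InLam.of_coeff hM.wt hσ0 (hα i)
  obtain ⟨ρy, hρy, Ky, hKy⟩ : InLam M y := by
    obtain ⟨k', rfl⟩ : ∃ k', k = k' + 1 := ⟨k - 1, by omega⟩
    exact root_in_Lam hM α hαL y k' (hlow k' (by omega)) hkne
  obtain ⟨m, D', hD, hD'⟩ := exists_order hkne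
  set ρ : ℝ := max (2*σ0) ρy with hρd
  have hρ1 : 1 ≤ ρ := hρy.trans (le_max_right _ _)
  have hρ0 : 0 < ρ := by linarith
  set K : ℝ := max (3*C0) Ky with hKd
  have hK1 : 1 ≤ K := (by linarith : (1:ℝ) ≤ 3 * C0).trans (le_max_left _ _)
  set W := wt M ρ with hWd
  have hW : Wt W := wt_wt hM.wt hρ0
  set K2 := Cst d K with hK2
  have hK21 : 1 ≤ K2 := Cst_ge hK1
  have hyK : ∀ N, nrm W N y ≤ K := fun N =>
    (nrm_anti hM.wt (by linarith) (le_max_right _ _) N y).trans ((hKy N).trans (le_max_right _ _))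
  have haK : ∀ i N, ∀ z ∈ Sec c R, nu W N z (a i z, α i) ≤ K := by
    intro i N z hz
    refine (nu_pair_le hW (Sec_ne_zero hz) (ha i N z hz)).trans ?_
    have h1 : nrm W N (α i) ≤ C0 * 2 :=
      nrm_of_coeff hM.wt (by linarith) (le_max_left _ _) (hα i) N
    have h2 : C0 * σ0 ^ N * M N / W N ≤ C0 := by
      rw [div_le_iff₀ (hW.pos N), hWd, wt]
      have p := hM.wt.pos N
      have : σ0 ^ N ≤ ρ ^ N := by
        gcongr
        exact (by linarith : σ0 ≤ 2*σ0).trans (le_max_left _ _)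
      calc C0 * σ0 ^ N * M N ≤ C0 * ρ ^ N * M N := by gcongr
        _ = _ := by ring
    exact (by linarith : _ ≤ 3 * C0).trans (le_max_left _ _)
  obtain ⟨B, hB⟩ := hh (m+1)
  have hWq := hW.pos (m+1)
  set E : ℝ := max B 0 + K * W (m+1) with hE
  have hE0 : 0 ≤ E := by
    have := le_max_right B 0
    positivity
  set s := ‖PowerSeries.coeff 0 D'‖ with hs
  have hs0 : 0 < s := norm_pos_iff.2 hD'
  obtain ⟨δ, hδ0, hδ1, hδE, hδs⟩ := exists_small (a := E) (b := K2 * W (m+1) + (d+1) * K2 * E)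
    (s := s/2) (by positivity) hE0 (by positivity)
  set C3 : ℝ := 2 * (d+1) * K2 / s with hC3
  have hC30 : 0 < C3 := by positivity
  have hMq := hM.wt.pos (m+1)
  set C4 : ℝ := max 1 (C3 * ρ ^ (m+1) * M (m+1)) * A ^ (m+1) with hC4
  have hC41 : 0 ≤ C4 := by positivity
  have hσ1 : 1 ≤ ρ * A ^ k := one_le_mul_of_one_le_of_one_le hρ1 (one_le_pow₀ hA1)
  refine ⟨k, m, ρ, δ, C4 + K, ρ * A ^ k, hk1, hρ1, hδ0, by positivity, hσ1, ?_⟩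
  intro n z hz hzδ hcond
  have hz0 := Sec_ne_zero hz
  have hz1 : ‖z‖ ≤ 1 := hzδ.trans hδ1
  have hN := wt_down hM.wt hρ0 hz0.le hcond
  set N := k*n+m+1 with hNd
  have hnN : n ≤ N := by
    have : 1 * n ≤ k * n := Nat.mul_le_mul_right n hk1
    omega
  set w := h z - tv N y z with hw
  have htl : ∀ j, j ≤ N → ‖tv N y z - tv j y z‖ ≤ K * (W j * ‖z‖ ^ j) := by
    intro j hj
    have h1 := tail_le hW hj (tv N y z, y) hz0 hN
    have h2 : nu W N z (tv N y z, y) = nrm W N y := by simp [nu]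
    rw [h2] at h1
    refine h1.trans ?_
    have := hW.pos j
    have := hyK N
    gcongr
  have hwE : ‖w‖ ≤ E * ‖z‖ ^ (m+1) := by
    have h1 : w = (h z - tv (m+1) y z) - (tv N y z - tv (m+1) y z) := by rw [hw]; ring
    rw [h1]
    refine (norm_sub_le _ _).trans ?_
    have h2 := hB z hz
    have h3 := htl (m+1) (by omega)
    have h4 : B * ‖z‖ ^ (m+1) ≤ max B 0 * ‖z‖ ^ (m+1) := by gcongr; exact le_max_left _ _
    rw [hE]; linarith
  have hzE : ‖z‖ * E ≤ 1 := (mul_le_mul_of_nonneg_right hzδ hE0).trans hδE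
  have hzp : ‖z‖ ^ (m+1) ≤ ‖z‖ := by
    rw [pow_succ]
    have : ‖z‖ ^ m ≤ 1 := pow_le_one₀ hz0.le hz1
    nlinarith
  have hw1 : ‖w‖ ≤ 1 := by
    refine hwE.trans (le_trans ?_ hzE)
    rw [mul_comm]; gcongr
  have hpt := pointwise hW (N := N) (m := m) (k := k) (by omega) hz0 hN hK1
    (fun i => haK i N z hz) (hyK N) (by rw [gen_eval]; exact heq z hz) hlow hkd hD hw1
  rw [← hK2, ← hs, ← hw] at hpt
  have hWN := hW.pos N
  have hmain : s / 2 * ‖z‖ ^ m * ‖w‖ ^ k ≤ (d+1) * (K2 * (W N * ‖z‖ ^ N)) := by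
    have h1 : ‖z‖ * (K2 * W (m+1) + (d+1) * K2 * E) ≤ s / 2 :=
      (mul_le_mul_of_nonneg_right hzδ (by positivity)).trans hδs
    have h2 : s / 2 * ‖z‖ ^ m ≤ s * ‖z‖ ^ m - K2 * (W (m+1) * ‖z‖ ^ (m+1))
        - (d+1) * K2 * ‖w‖ := by
      have h3 : (d+1) * K2 * ‖w‖ ≤ (d+1) * K2 * (E * ‖z‖ ^ (m+1)) := by gcongr
      have h4 := mul_le_mul_of_nonneg_right h1 (pow_nonneg hz0.le m)
      have h5 : ‖z‖ ^ (m+1) = ‖z‖ ^ m * ‖z‖ := pow_succ _ _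
      rw [h5] at h3 ⊢
      nlinarith
    have h6 := mul_le_mul_of_nonneg_right h2 (pow_nonneg (norm_nonneg w) k)
    rw [pow_succ ‖w‖ k] at hpt
    nlinarith
  have hwk : ‖w‖ ^ k ≤ C3 * W N * ‖z‖ ^ (k*n) := by
    have h1 : ‖z‖ ^ N ≤ ‖z‖ ^ m * ‖z‖ ^ (k*n) := by
      rw [← pow_add]
      exact pow_le_pow_of_le_one hz0.le hz1 (by omega)
    have hzm : 0 < ‖z‖ ^ m := by positivity
    refine le_of_mul_le_mul_left ?_ (show 0 < s / 2 * ‖z‖ ^ m by positivity)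
    refine hmain.trans ?_
    calc (d+1) * (K2 * (W N * ‖z‖ ^ N)) ≤ (d+1) * (K2 * (W N * (‖z‖ ^ m * ‖z‖ ^ (k*n)))) := by
          gcongr
      _ = _ := by rw [hC3]; field_simp
  have hMn := hM.wt.pos n
  have hwn : ‖w‖ ≤ C4 * (ρ * A ^ k) ^ n * M n * ‖z‖ ^ n := by
    refine le_of_pow_le_pow_left₀ (n := k) (by omega) (by positivity) (hwk.trans ?_)
    have h1 := M_kn hM k n (m+1)
    have h2 : W N ≤ (A ^ (k*n+(m+1))) ^ k * (M n) ^ k * M (m+1) * ρ ^ (k*n+(m+1)) := by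
      rw [hWd, wt, hNd]
      exact mul_le_mul_of_nonneg_right h1 (by positivity)
    set x := C3 * ρ ^ (m+1) * M (m+1) with hx
    have h3 : x ≤ (max 1 x) ^ k := by
      refine (le_max_right 1 x).trans ?_
      exact le_self_pow₀ (le_max_left _ _) (by omega)
    calc C3 * W N * ‖z‖ ^ (k*n) ≤ C3 * ((A ^ (k*n+(m+1))) ^ k * (M n) ^ k * M (m+1) *
            ρ ^ (k*n+(m+1))) * ‖z‖ ^ (k*n) := by gcongr
      _ = x * ((A ^ (m+1)) ^ k * (ρ ^ (k*n) * (A ^ (k*n)) ^ k) * (M n) ^ k * ‖z‖ ^ (k*n)) := by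
          rw [hx]; ring
      _ ≤ (max 1 x) ^ k * ((A ^ (m+1)) ^ k * (ρ ^ (k*n) * (A ^ (k*n)) ^ k) * (M n) ^ k
            * ‖z‖ ^ (k*n)) := by gcongr
      _ = _ := by
          rw [hC4]
          simp only [mul_pow, ← pow_mul]
          ring_nf
  have h1 : h z - tv n y z = w + (tv N y z - tv n y z) := by rw [hw]; ring
  rw [h1]
  refine (norm_add_le _ _).trans ?_
  have h2 := htl n hnN
  have h3 : W n ≤ (ρ * A ^ k) ^ n * M n := by
    rw [hWd, wt, mul_comm (M n)]
    gcongr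
    nlinarith [one_le_pow₀ hA1 (n := k)]
  have h4 : K * (W n * ‖z‖ ^ n) ≤ K * ((ρ * A ^ k) ^ n * M n * ‖z‖ ^ n) := by gcongr
  calc ‖w‖ + ‖tv N y z - tv n y z‖ ≤ C4 * (ρ * A ^ k) ^ n * M n * ‖z‖ ^ n
        + K * ((ρ * A ^ k) ^ n * M n * ‖z‖ ^ n) := add_le_add hwn (h2.trans h4)
    _ = _ := by ring

lemma iter_sub_tv {U : Set ℂ} (hU : IsOpen U) {h : ℂ → ℂ} (hh : DifferentiableOn ℂ h U) (n : ℕ)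
    (y : PowerSeries ℂ) {z : ℂ} (hz : z ∈ U) :
    iteratedDeriv n (fun w => h w - tv n y w) z = iteratedDeriv n h z := by
  have h1 : ContDiffAt ℂ n h z := (hh.contDiffOn hU).contDiffAt (hU.mem_nhds hz)
  have h2 : ContDiffAt ℂ n (fun w => tv n y w) z := by
    unfold tv
    fun_prop
  rw [iteratedDeriv_fun_sub h1 h2]
  have h3 : iteratedDeriv n (fun w => tv n y w) z = 0 := by
    unfold tv
    rw [iteratedDeriv_fun_sum (fun i _ => by fun_prop)]
    apply Finset.sum_eq_zero
    intro k hk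
    rw [iteratedDeriv_const_mul_field, iteratedDeriv_pow,
      Nat.descFactorial_eq_zero_iff_lt.2 (Finset.mem_range.1 hk)]
    simp
  rw [h3, sub_zero]

lemma mu_bound {M : ℕ → ℝ} {A : ℝ} (hM : SR M A) {k : ℕ} (hk : 1 ≤ k) (m n : ℕ) :
    (M (k*n+m+1) / M (k*n+m)) ^ n ≤ (M m * A ^ (3*m)) * (A ^ (2+k)) ^ n * M n := by
  have hA := hM.one_le
  set N := k*n+m with hN
  have pN := hM.wt.pos N
  set μ := M (N+1) / M N with hμ
  have hμ1 : 1 ≤ μ := by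
    rw [hμ, one_le_div pN]; exact hM.mono (Nat.le_succ N)
  have e1 : M (N+1) = μ * M N := by rw [hμ]; field_simp
  have hj : ∀ j, μ ^ j * M N ≤ M (N+j) := by
    intro j
    induction j with
    | zero => simp
    | succ j ih =>
      have h1 := hM.wt.ratio N j
      rw [e1] at h1
      have h2 : μ * M (N+j) ≤ M (N+j+1) := by
        refine le_of_mul_le_mul_left ?_ pN
        linarith
      calc μ ^ (j+1) * M N = μ * (μ ^ j * M N) := by ring
        _ ≤ μ * M (N+j) := by gcongr
        _ ≤ _ := h2
  have h3 : μ ^ N ≤ A ^ (N+N) * M N := by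
    refine le_of_mul_le_mul_right ?_ pN
    refine (hj N).trans ((hM.mg N N).trans (le_of_eq ?_))
    ring
  have pn := hM.wt.pos n
  have pm := hM.wt.pos m
  have h4 := M_kn hM k n m
  rw [← hN] at h4
  refine le_of_pow_le_pow_left₀ (n := k) (by omega) (by positivity) ?_
  have hm1 : M m ≤ (M m) ^ k := le_self_pow₀ (hM.one_le_M m) (by omega)
  have hA2 : A ^ (2*m) ≤ (A ^ (2*m)) ^ k := le_self_pow₀ (one_le_pow₀ hA) (by omega)
  calc (μ ^ n) ^ k = μ ^ (k*n) := by rw [← pow_mul, mul_comm]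
    _ ≤ μ ^ N := pow_le_pow_right₀ hμ1 (by omega)
    _ ≤ A ^ (N+N) * M N := h3
    _ ≤ A ^ (N+N) * ((A ^ N) ^ k * (M n) ^ k * M m) := by gcongr
    _ = A ^ (2*m) * ((A ^ (2*n)) ^ k * ((A ^ N) ^ k * (M n) ^ k * M m)) := by
        rw [hN]; ring
    _ ≤ (A ^ (2*m)) ^ k * ((A ^ (2*n)) ^ k * ((A ^ N) ^ k * (M n) ^ k * (M m) ^ k)) := by
        gcongr
    _ = _ := by
        simp only [hN]
        rw [← mul_pow, ← mul_pow, ← mul_pow, ← mul_pow]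
        congr 1
        ring

lemma main_sec {c c' R R' : ℝ} (hc : |c| ≤ 1) (hc1 : c < 1) (hcc : c < c') (hR' : 0 < R')
    (hRR : R' < R) {M : ℕ → ℝ} {A : ℝ} (hM : SR M A) {d : ℕ} (hd : 1 ≤ d)
    {a : Fin d → ℂ → ℂ} {h : ℂ → ℂ}
    (had : ∀ i, DifferentiableOn ℂ (a i) (Sec c R))
    (ha : ∀ i, ∃ C > (0:ℝ), ∃ σ > (0:ℝ), ∀ (j : ℕ), ∀ z ∈ Sec c R,
      ‖iteratedDeriv j (a i) z‖ ≤ C * σ ^ j * (Nat.factorial j : ℝ) * M j)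
    (hhd : DifferentiableOn ℂ h (Sec c R))
    (hh : ∀ j : ℕ, ∃ B : ℝ, ∀ z ∈ Sec c R, ‖iteratedDeriv j h z‖ ≤ B)
    (heq : ∀ z ∈ Sec c R, h z ^ d + ∑ i : Fin d, a i z * h z ^ (d - 1 - (i : ℕ)) = 0) :
    ∃ C > (0:ℝ), ∃ σ > (0:ℝ), ∀ (j : ℕ), ∀ z ∈ Sec c' R',
      ‖iteratedDeriv j h z‖ ≤ C * σ ^ j * (Nat.factorial j : ℝ) * M j := by
  have hR : 0 < R := hR'.trans hRR
  have hA1 := hM.one_le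
  choose Ca hCa σa hσa hab using ha
  set C0 : ℝ := 1 + ∑ i, Ca i with hC0d
  set σ0 : ℝ := 1 + ∑ i, σa i with hσ0d
  have hC0 : 1 ≤ C0 := by
    have := Finset.sum_nonneg (s := Finset.univ) (fun i _ => (hCa i).le)
    linarith
  have hσ0 : 1 ≤ σ0 := by
    have := Finset.sum_nonneg (s := Finset.univ) (fun i _ => (hσa i).le)
    linarith
  have hab' : ∀ i (j : ℕ), ∀ z ∈ Sec c R,
      ‖iteratedDeriv j (a i) z‖ ≤ C0 * σ0 ^ j * M j * (Nat.factorial j : ℝ) := by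
    intro i j z hz
    have h1 : Ca i ≤ C0 := by
      have := Finset.single_le_sum (f := Ca) (fun i _ => (hCa i).le) (Finset.mem_univ i)
      linarith
    have h2 : σa i ≤ σ0 := by
      have := Finset.single_le_sum (f := σa) (fun i _ => (hσa i).le) (Finset.mem_univ i)
      linarith
    have p := hM.wt.pos j
    have p1 := hσa i
    calc _ ≤ Ca i * σa i ^ j * (Nat.factorial j : ℝ) * M j := hab i j z hz
      _ ≤ C0 * σ0 ^ j * (Nat.factorial j : ℝ) * M j := by gcongr
      _ = _ := by ring
  have hexp : ∀ i, ∃ x : PowerSeries ℂ, ∀ (N : ℕ) (B : ℝ),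
      (∀ z ∈ Sec c R, ‖iteratedDeriv N (a i) z‖ ≤ B) →
      (∀ z ∈ Sec c R, ‖a i z - tv N x z‖ ≤ B / N.factorial * ‖z‖ ^ N) ∧
      ‖PowerSeries.coeff N x‖ ≤ B / N.factorial := fun i =>
    expansion hc hc1 hR (had i) (fun j => ⟨_, hab' i j⟩)
  choose α hα using hexp
  obtain ⟨y, hy⟩ := expansion hc hc1 hR hhd hh
  have hdiv : ∀ N : ℕ, C0 * σ0 ^ N * M N * (Nat.factorial N : ℝ) / (Nat.factorial N : ℝ) =
      C0 * σ0 ^ N * M N := fun N => by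
    have : (Nat.factorial N : ℝ) ≠ 0 := by positivity
    field_simp
  obtain ⟨k, m, ρ, δ, C, σ, hk, hρ, hδ, hC, hσ, hcore⟩ := core hc1 hR hM hd (a := a) (h := h)
    (α := α) (y := y) hC0 hσ0
    (fun i N z hz => by have := (hα i N _ (hab' i N)).1 z hz; rwa [hdiv] at this)
    (fun i N => by have := (hα i N _ (hab' i N)).2; rwa [hdiv] at this)
    (fun N => by
      obtain ⟨B, hB⟩ := hh N
      exact ⟨_, (hy N B hB).1⟩) heq
  obtain ⟨B0', hB0'⟩ := hh 0
  set B0 : ℝ := max B0' 0 with hB0d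
  have hB00 : 0 ≤ B0 := le_max_right _ _
  have hB0 : ∀ z ∈ Sec c R, ‖h z‖ ≤ B0 := fun z hz => by
    have := hB0' z hz
    rw [iteratedDeriv_zero] at this
    exact this.trans (le_max_left _ _)
  obtain ⟨ε, hε0, hε1, hεc, hεR⟩ : ∃ ε : ℝ, 0 < ε ∧ ε ≤ 1 ∧ 2 * ε ≤ c' - c ∧ R' * (1 + ε) ≤ R := by
    obtain ⟨ε, h0, h1, h2, h3⟩ := exists_small (a := 2 / (c' - c)) (b := R') (s := R - R')
      (by linarith) (by have : 0 < c' - c := by linarith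
                        positivity) hR'.le
    refine ⟨ε, h0, h1, ?_, by linarith⟩
    have : 0 < c' - c := by linarith
    rw [mul_div_assoc', div_le_one this] at h2
    linarith
  set τ : ℝ := (2 / δ + 2 * ρ) / ε with hτ
  have hτ0 : 0 < τ := by positivity
  set C5 : ℝ := M m * A ^ (3*m) with hC5
  have pm := hM.wt.pos m
  have hC50 : 0 < C5 := by positivity
  refine ⟨C + B0 * C5 + 1, by positivity, 2 * σ / ε + τ * A ^ (2+k), by positivity, ?_⟩
  intro n z hz
  have hz0 := Sec_ne_zero hz
  have pn := hM.wt.pos n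
  have hrad : 0 < ε * ‖z‖ := by positivity
  have hsub : Metric.closedBall z (ε * ‖z‖) ⊆ Sec c R := by
    intro w hw
    rw [mem_closedBall_iff_norm] at hw
    exact Sec_ball hc hεc hε0 hεR hz hw
  have hzS : z ∈ Sec c R := hsub (Metric.mem_closedBall_self hrad.le)
  have hfac : (0:ℝ) < n.factorial := by positivity
  by_cases hcase : 2 * ‖z‖ ≤ δ ∧ 2 * ‖z‖ * (ρ * M (k*n+m+1)) ≤ M (k*n+m)
  · have hd1 : DifferentiableOn ℂ (fun w => h w - tv n y w) (Sec c R) := by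
      apply hhd.sub
      unfold tv
      fun_prop
    have h1 := Complex.norm_iteratedDeriv_le_of_forall_mem_sphere_norm_le n hrad
      (hd1.diffContOnCl_ball hsub) (C := C * σ ^ n * M n * (2 * ‖z‖) ^ n) (by
        intro w hw
        have hwS := hsub (Metric.sphere_subset_closedBall hw)
        have hw2 : ‖w‖ ≤ 2 * ‖z‖ := by
          rw [mem_sphere_iff_norm] at hw
          have h3 := norm_add_le (w - z) z
          rw [sub_add_cancel, hw] at h3
          nlinarith
        have p1 := hM.wt.pos (k*n+m+1)
        refine (hcore n w hwS (hw2.trans hcase.1) (le_trans ?_ hcase.2)).trans ?_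
        · gcongr
        · gcongr)
    rw [iter_sub_tv (isOpen_Sec c R) hhd n y hzS] at h1
    refine h1.trans ?_
    have e : n.factorial * (C * σ ^ n * M n * (2 * ‖z‖) ^ n) / (ε * ‖z‖) ^ n =
        C * (2 * σ / ε) ^ n * n.factorial * M n := by
      rw [mul_pow, mul_pow, div_pow, mul_pow]
      have : ‖z‖ ^ n ≠ 0 := by positivity
      field_simp
    rw [e]
    have h2 : C ≤ C + B0 * C5 + 1 := by nlinarith [mul_nonneg hB00 hC50.le]
    have h3 : 2 * σ / ε ≤ 2 * σ / ε + τ * A ^ (2+k) := by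
      have : 0 < τ * A ^ (2+k) := by positivity
      linarith
    gcongr
  · have h1 := Complex.norm_iteratedDeriv_le_of_forall_mem_sphere_norm_le n hrad
      (hhd.diffContOnCl_ball hsub) (C := B0) (fun w hw =>
        hB0 w (hsub (Metric.sphere_subset_closedBall hw)))
    refine h1.trans ?_
    have pN := hM.wt.pos (k*n+m)
    have hmu := mu_bound hM hk m n
    rw [← hC5] at hmu
    set μ := M (k*n+m+1) / M (k*n+m) with hμ
    have hμ1 : 1 ≤ μ := by
      rw [hμ, one_le_div pN]; exact hM.mono (Nat.le_succ _)
    have hinv : 1 ≤ (2 / δ + 2 * ρ) * μ * ‖z‖ := by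
      have e1 : M (k*n+m+1) = μ * M (k*n+m) := by rw [hμ]; field_simp
      rw [e1] at hcase
      by_cases hcs : 2 * ‖z‖ ≤ δ
      · have h3 : M (k*n+m) < 2 * ‖z‖ * (ρ * (μ * M (k*n+m))) := by
          by_contra hcon
          exact hcase ⟨hcs, not_lt.1 hcon⟩
        have h4 : 1 ≤ 2 * ρ * μ * ‖z‖ := by
          refine le_of_mul_le_mul_right ?_ pN
          linarith
        have h5 : 0 ≤ 2 / δ * μ * ‖z‖ := by positivity
        linarith
      · have h3 : 1 ≤ 2 / δ * ‖z‖ := by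
          rw [div_mul_eq_mul_div, one_le_div hδ]; linarith
        have h4 : 2 / δ * ‖z‖ ≤ 2 / δ * ‖z‖ * μ := le_mul_of_one_le_right (by positivity) hμ1
        have h5 : 0 ≤ 2 * ρ * μ * ‖z‖ := by positivity
        linarith
    have h2 : 1 ≤ (τ * μ) ^ n * (ε * ‖z‖) ^ n := by
      rw [← mul_pow]
      apply one_le_pow₀
      have : τ * μ * (ε * ‖z‖) = (2 / δ + 2 * ρ) * μ * ‖z‖ := by rw [hτ]; field_simp
      rw [this]; exact hinv
    rw [div_le_iff₀ (by positivity)]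
    calc n.factorial * B0 ≤ n.factorial * B0 * ((τ * μ) ^ n * (ε * ‖z‖) ^ n) :=
          le_mul_of_one_le_right (by positivity) h2
      _ = n.factorial * B0 * (τ ^ n * μ ^ n) * (ε * ‖z‖) ^ n := by rw [mul_pow]; ring
      _ ≤ n.factorial * B0 * (τ ^ n * (C5 * (A ^ (2+k)) ^ n * M n)) * (ε * ‖z‖) ^ n := by gcongr
      _ = B0 * C5 * (τ * A ^ (2+k)) ^ n * n.factorial * M n * (ε * ‖z‖) ^ n := by
          rw [mul_pow τ]; ring
      _ ≤ _ := by
        have h6 : B0 * C5 ≤ C + B0 * C5 + 1 := by linarith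
        have h7 : τ * A ^ (2+k) ≤ 2 * σ / ε + τ * A ^ (2+k) := by
          have : 0 < 2 * σ / ε := by positivity
          linarith
        gcongr

/-- Smooth roots of ultraholomorphic polynomials: a root `h ∈ A^∞(S_{γ,r})` of a
monic polynomial with coefficients in `A_M(S_{γ,r})` belongs to `A_M(S_{γ',r'})`
for all `γ' < γ`, `r' < r`. -/
theorem smooth_root_ultraholomorphic
    (γ : ℝ) (hγ0 : 0 < γ) (hγ2 : γ < 2)
    (r : ℝ≥0∞) (hr0 : 0 < r) (hrt : r < ⊤)
    (M : ℕ → ℝ) (hM : StronglyRegular M)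
    (d : ℕ) (hd : 1 ≤ d) (a : Fin d → ℂ → ℂ) (ha : ∀ i, AClass M γ r (a i))
    (h : ℂ → ℂ) (hh : AInfty γ r h)
    (heq : ∀ z ∈ Sector γ r,
      h z ^ d + ∑ i : Fin d, a i z * h z ^ (d - 1 - (i : ℕ)) = 0) :
    ∀ (γ' : ℝ) (r' : ℝ≥0∞), 0 < γ' → γ' < γ → 0 < r' → r' < r →
      AClass M γ' r' h := by
  intro γ' r' hγ'0 hγ' hr'0 hr'
  have hr't : r' < ⊤ := hr'.trans hrt
  have hγ'2 : γ' < 2 := hγ'.trans hγ2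
  have hpi := Real.pi_pos
  have hS : Sector γ r = Sec (Real.cos (γ * Real.pi / 2)) r.toReal :=
    Set.ext fun z => mem_sector_iff hγ0 hγ2 hrt z
  have hS' : Sector γ' r' = Sec (Real.cos (γ' * Real.pi / 2)) r'.toReal :=
    Set.ext fun z => mem_sector_iff hγ'0 hγ'2 hr't z
  have hsub : Sector γ' r' ⊆ Sector γ r := by
    intro z hz
    refine ⟨hz.1, hz.2.1.trans_le ?_, hz.2.2.trans hr'⟩
    gcongr
  have hcc : Real.cos (γ * Real.pi / 2) < Real.cos (γ' * Real.pi / 2) := by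
    apply Real.cos_lt_cos_of_nonneg_of_le_pi (by positivity)
    · nlinarith
    · gcongr
  have hc1 : Real.cos (γ * Real.pi / 2) < 1 := hcc.trans_le (Real.cos_le_one _)
  obtain ⟨A, hA⟩ := hM.sr
  refine ⟨⟨hh.1.mono hsub, fun j => ?_⟩, ?_⟩
  · obtain ⟨B, hB⟩ := hh.2 j
    exact ⟨B, fun z hz => hB z (hsub hz)⟩
  · rw [hS']
    refine main_sec (Real.abs_cos_le_one _) hc1 hcc
      (ENNReal.toReal_pos hr'0.ne' hr't.ne) ((ENNReal.toReal_lt_toReal hr't.ne hrt.ne).2 hr') hA hd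
      (a := a) ?_ ?_ ?_ ?_ ?_
    · intro i; rw [← hS]; exact (ha i).1.1
    · intro i; rw [← hS]; exact (ha i).2
    · rw [← hS]; exact hh.1
    · rw [← hS]; exact hh.2
    · rw [← hS]; exact heq
end
end
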